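/- arXiv:2502.00403 — 6 statements merged into one kernel-verified Lean document; each statement's English description precedes it below -/
import Mathlib

section
/- Let a, b be natural numbers with either b > a ≥ 3, or (a,b) = (2,3). Then for every ε > 0 the curve γ_ε : [0,ε] → ℝ³, γ_ε(t) = (t^{b/a}, t, 0) (real power), is NOT length-minimizing: there exist τ > 0 and a horizontal curve η̃ : [0,τ] → ℝ³ with η̃(0) = (0,0,0), η̃(τ) = (ε^{b/a}, ε, 0), and L(η̃) < L(γ_ε) = ∫₀^ε √(1 + (b/a)² t^{2(b/a)−2}) dt. -/
open MeasureTheory Set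

/-- A horizontal curve for the sub-Riemannian structure on `ℝ³` spanned by the orthonormal
frame `X₁ = ∂_{x₁}`, `X₂ = ∂_{x₂} + P²∂_{x₃}` with `P(x₁,x₂) = x₁^a - x₂^b`:
an absolutely continuous curve `(x,y,z) : [0,τ] → ℝ³` with a.e. derivatives `(d1, d2, d2·P²)`. -/
structure HorizontalCurve (a b : ℕ) (τ : ℝ) where
  x : ℝ → ℝ
  y : ℝ → ℝ
  z : ℝ → ℝ
  d1 : ℝ → ℝ
  d2 : ℝ → ℝ
  hd1 : IntervalIntegrable d1 volume 0 τ
  hd2 : IntervalIntegrable d2 volume 0 τ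
  hx : ∀ t ∈ Icc (0:ℝ) τ, x t = x 0 + ∫ s in (0:ℝ)..t, d1 s
  hy : ∀ t ∈ Icc (0:ℝ) τ, y t = y 0 + ∫ s in (0:ℝ)..t, d2 s
  hz : ∀ t ∈ Icc (0:ℝ) τ, z t = z 0 + ∫ s in (0:ℝ)..t, d2 s * ((x s) ^ a - (y s) ^ b) ^ 2

/-- The sub-Riemannian length of a horizontal curve, i.e. the Euclidean length of its planar
projection. -/
noncomputable def HorizontalCurve.length {a b : ℕ} {τ : ℝ} (η : HorizontalCurve a b τ) : ℝ :=
  ∫ t in (0:ℝ)..τ, Real.sqrt (η.d1 t ^ 2 + η.d2 t ^ 2)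

/-- `Reachable a b p q L` says that some horizontal curve of length `L`, with integrable speed and
integrable vertical velocity, joins `p` to `q`. -/
def Reachable (a b : ℕ) (p q : ℝ × ℝ × ℝ) (L : ℝ) : Prop :=
  ∃ τ : ℝ, 0 ≤ τ ∧ ∃ η : HorizontalCurve a b τ,
    (η.x 0, η.y 0, η.z 0) = p ∧ (η.x τ, η.y τ, η.z τ) = q ∧ η.length = L ∧
    IntervalIntegrable (fun s => η.d2 s * ((η.x s) ^ a - (η.y s) ^ b) ^ 2) volume 0 τ ∧
    IntervalIntegrable (fun s => Real.sqrt (η.d1 s ^ 2 + η.d2 s ^ 2)) volume 0 τ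

/-- The concatenation at time `c` of two functions of time. -/
noncomputable def concatAt (c : ℝ) (f g : ℝ → ℝ) (s : ℝ) : ℝ := if s ≤ c then f s else g (s - c)

lemma concatAt_of_le {c s : ℝ} (f g : ℝ → ℝ) (h : s ≤ c) : concatAt c f g s = f s := if_pos h

lemma concatAt_of_lt {c s : ℝ} (f g : ℝ → ℝ) (h : c < s) : concatAt c f g s = g (s - c) :=
  if_neg h.not_ge

lemma intervalIntegrable_concatAt {c d : ℝ} (hc : 0 ≤ c) (hd : 0 ≤ d) {f g : ℝ → ℝ}
    (hf : IntervalIntegrable f volume 0 c) (hg : IntervalIntegrable g volume 0 d) :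
    IntervalIntegrable (concatAt c f g) volume 0 (c + d) := by
  have hg' := hg.comp_sub_right c
  simp only [zero_add] at hg'
  rw [add_comm d c] at hg'
  refine IntervalIntegrable.trans (b := c) (hf.congr ?_) (hg'.congr ?_)
  · intro s hs
    rw [uIoc_of_le hc] at hs
    exact (concatAt_of_le f g hs.2).symm
  · intro s hs
    rw [uIoc_of_le (by linarith)] at hs
    exact (concatAt_of_lt f g hs.1).symm

lemma integral_concatAt_left {c t : ℝ} (ht0 : 0 ≤ t) (ht : t ≤ c) (f g : ℝ → ℝ) :
    ∫ s in (0:ℝ)..t, concatAt c f g s = ∫ s in (0:ℝ)..t, f s := by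
  refine intervalIntegral.integral_congr fun s hs => ?_
  rw [uIcc_of_le ht0] at hs
  exact concatAt_of_le f g (hs.2.trans ht)

lemma integral_concatAt_right {c d t : ℝ} (hc : 0 ≤ c) (ht : c ≤ t) (htd : t ≤ c + d)
    {f g : ℝ → ℝ} (hf : IntervalIntegrable f volume 0 c) (hg : IntervalIntegrable g volume 0 d) :
    ∫ s in (0:ℝ)..t, concatAt c f g s =
      (∫ s in (0:ℝ)..c, f s) + ∫ s in (0:ℝ)..(t - c), g s := by
  have hI := intervalIntegrable_concatAt hc (by linarith) hf hg
  rw [← intervalIntegral.integral_add_adjacent_intervals (b := c)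
    (hI.mono_set (by
      rw [uIcc_of_le hc, uIcc_of_le (by linarith)]; exact Icc_subset_Icc le_rfl (by linarith)))
    (hI.mono_set (by
      rw [uIcc_of_le ht, uIcc_of_le (by linarith)]; exact Icc_subset_Icc hc htd)),
    integral_concatAt_left hc le_rfl]
  congr 1
  have : ∫ s in c..t, g (s - c) = ∫ s in (0:ℝ)..(t - c), g s := by
    rw [intervalIntegral.integral_comp_sub_right]; simp
  rw [← this]
  refine intervalIntegral.integral_congr_uIoo fun s hs => ?_
  rw [uIoo_of_le ht] at hs
  exact concatAt_of_lt f g hs.1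

/-- Gluing two primitives with matching values gives a primitive of the glued integrands. -/
lemma concatAt_eq_add_integral {c d : ℝ} (hc : 0 ≤ c) {u v f g : ℝ → ℝ}
    (hf : IntervalIntegrable f volume 0 c) (hg : IntervalIntegrable g volume 0 d)
    (hu : ∀ t ∈ Icc (0:ℝ) c, u t = u 0 + ∫ s in (0:ℝ)..t, f s)
    (hv : ∀ t ∈ Icc (0:ℝ) d, v t = v 0 + ∫ s in (0:ℝ)..t, g s) (huv : u c = v 0) :
    ∀ t ∈ Icc (0:ℝ) (c + d),
      concatAt c u v t = concatAt c u v 0 + ∫ s in (0:ℝ)..t, concatAt c f g s := by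
  intro t ht
  rw [concatAt_of_le u v hc]
  rcases le_or_gt t c with h | h
  · rw [concatAt_of_le u v h, integral_concatAt_left ht.1 h, hu t ⟨ht.1, h⟩]
  · rw [concatAt_of_lt u v h, integral_concatAt_right hc h.le ht.2 hf hg,
      hv (t - c) ⟨by linarith, by linarith [ht.2]⟩, ← huv, hu c ⟨hc, le_rfl⟩, add_assoc]

lemma concatAt_end {c d : ℝ} (hd : 0 ≤ d) {u v : ℝ → ℝ} (huv : u c = v 0) :
    concatAt c u v (c + d) = v d := by
  rcases hd.eq_or_lt with rfl | hd
  · rw [add_zero, concatAt_of_le _ _ le_rfl, huv]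
  · rw [concatAt_of_lt _ _ (by linarith), add_sub_cancel_left]

lemma Reachable.trans {a b : ℕ} {p q r : ℝ × ℝ × ℝ} {L M : ℝ}
    (h₁ : Reachable a b p q L) (h₂ : Reachable a b q r M) : Reachable a b p r (L + M) := by
  obtain ⟨c, hc, η, rfl, rfl, rfl, hz, hl⟩ := h₁
  obtain ⟨d, hd, θ, h0, rfl, rfl, hz', hl'⟩ := h₂
  simp only [Prod.mk.injEq] at h0
  obtain ⟨hx0, hy0, hz0⟩ := h0
  have key : (fun s => concatAt c η.d2 θ.d2 s *
      (concatAt c η.x θ.x s ^ a - concatAt c η.y θ.y s ^ b) ^ 2) =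
      concatAt c (fun s => η.d2 s * (η.x s ^ a - η.y s ^ b) ^ 2)
        (fun s => θ.d2 s * (θ.x s ^ a - θ.y s ^ b) ^ 2) := by
    funext s
    unfold concatAt
    split_ifs <;> rfl
  have key' : (fun s => Real.sqrt (concatAt c η.d1 θ.d1 s ^ 2 + concatAt c η.d2 θ.d2 s ^ 2)) =
      concatAt c (fun s => Real.sqrt (η.d1 s ^ 2 + η.d2 s ^ 2))
        (fun s => Real.sqrt (θ.d1 s ^ 2 + θ.d2 s ^ 2)) := by
    funext s
    unfold concatAt
    split_ifs <;> rfl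
  refine ⟨c + d, by linarith,
    { x := concatAt c η.x θ.x
      y := concatAt c η.y θ.y
      z := concatAt c η.z θ.z
      d1 := concatAt c η.d1 θ.d1
      d2 := concatAt c η.d2 θ.d2
      hd1 := intervalIntegrable_concatAt hc hd η.hd1 θ.hd1
      hd2 := intervalIntegrable_concatAt hc hd η.hd2 θ.hd2
      hx := concatAt_eq_add_integral hc η.hd1 θ.hd1 η.hx θ.hx hx0.symm
      hy := concatAt_eq_add_integral hc η.hd2 θ.hd2 η.hy θ.hy hy0.symm
      hz := by
        rw [key]
        exact concatAt_eq_add_integral hc hz hz' η.hz θ.hz hz0.symm }, ?_, ?_, ?_, ?_, ?_⟩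
  · simp only [concatAt_of_le _ _ hc]
  · simp only [concatAt_end hd hx0.symm, concatAt_end hd hy0.symm, concatAt_end hd hz0.symm]
  · simp only [HorizontalCurve.length]
    rw [key', integral_concatAt_right hc (by linarith) le_rfl hl hl', add_sub_cancel_left]
  · simp only [key]
    exact intervalIntegrable_concatAt hc hd hz hz'
  · simp only [key']
    exact intervalIntegrable_concatAt hc hd hl hl'

/-- A continuously differentiable planar curve lifts to a horizontal curve. -/
lemma reachable_of_hasDerivAt (a b : ℕ) {u v : ℝ} (huv : u ≤ v) {x y d1 d2 : ℝ → ℝ}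
    (hd1 : ContinuousOn d1 (Icc u v)) (hd2 : ContinuousOn d2 (Icc u v))
    (hx : ∀ t ∈ Icc u v, HasDerivAt x (d1 t) t) (hy : ∀ t ∈ Icc u v, HasDerivAt y (d2 t) t)
    (z₀ : ℝ) :
    Reachable a b (x u, y u, z₀)
      (x v, y v, z₀ + ∫ s in u..v, d2 s * ((x s) ^ a - (y s) ^ b) ^ 2)
      (∫ s in u..v, Real.sqrt (d1 s ^ 2 + d2 s ^ 2)) := by
  have hmap : MapsTo (fun s => u + s) (Icc 0 (v - u)) (Icc u v) := fun s hs =>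
    ⟨by linarith [hs.1], by linarith [hs.2]⟩
  have hsh : ContinuousOn (fun s : ℝ => u + s) (Icc 0 (v - u)) := by fun_prop
  have hint : ∀ {f : ℝ → ℝ}, ContinuousOn f (Icc u v) →
      IntervalIntegrable (fun s => f (u + s)) volume 0 (v - u) := fun {f} hf =>
    (hf.comp hsh hmap).intervalIntegrable_of_Icc (by linarith)
  have hprim : ∀ {f g : ℝ → ℝ}, ContinuousOn g (Icc u v) →
      (∀ t ∈ Icc u v, HasDerivAt f (g t) t) → ∀ t ∈ Icc (0:ℝ) (v - u),
      f (u + t) = f (u + 0) + ∫ s in (0:ℝ)..t, g (u + s) := by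
    intro f g hg hf t ht
    have hsub : Icc u (u + t) ⊆ Icc u v := Icc_subset_Icc le_rfl (by linarith [ht.2])
    rw [intervalIntegral.integral_comp_add_left,
      intervalIntegral.integral_eq_sub_of_hasDerivAt]
    · ring
    · intro s hs
      rw [add_zero, uIcc_of_le (by linarith [ht.1])] at hs
      exact hf s (hsub hs)
    · rw [add_zero]
      exact (hg.mono hsub).intervalIntegrable_of_Icc (by linarith [ht.1])
  have hxc : ContinuousOn x (Icc u v) := fun t ht => (hx t ht).continuousAt.continuousWithinAt
  have hyc : ContinuousOn y (Icc u v) := fun t ht => (hy t ht).continuousAt.continuousWithinAt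
  refine ⟨v - u, by linarith,
    { x := fun s => x (u + s)
      y := fun s => y (u + s)
      z := fun t => z₀ + ∫ s in (0:ℝ)..t, d2 (u + s) * ((x (u + s)) ^ a - (y (u + s)) ^ b) ^ 2
      d1 := fun s => d1 (u + s)
      d2 := fun s => d2 (u + s)
      hd1 := hint hd1
      hd2 := hint hd2
      hx := hprim hd1 hx
      hy := hprim hd2 hy
      hz := fun t _ => by simp }, by simp, ?_, ?_, ?_, ?_⟩
  · simp only [add_sub_cancel, Prod.mk.injEq, add_right_inj, true_and]
    rw [intervalIntegral.integral_comp_add_left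
      (fun s => d2 s * ((x s) ^ a - (y s) ^ b) ^ 2)]
    simp
  · simp only [HorizontalCurve.length]
    rw [intervalIntegral.integral_comp_add_left
      (fun s => Real.sqrt (d1 s ^ 2 + d2 s ^ 2))]
    simp
  · exact hint (f := fun s => d2 s * ((x s) ^ a - (y s) ^ b) ^ 2) (by fun_prop)
  · exact hint (f := fun s => Real.sqrt (d1 s ^ 2 + d2 s ^ 2)) (by fun_prop)

/-- The decrease of the vertical coordinate along the boundary of the square of side `h` with
upper left corner `(X, Y)`, run clockwise. -/
noncomputable def squareHolonomy (a b : ℕ) (X Y h : ℝ) : ℝ :=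
  ∫ t in (0:ℝ)..h, (((X + h) ^ a - (Y - t) ^ b) ^ 2 - (X ^ a - (Y - t) ^ b) ^ 2)

lemma reachable_square (a b : ℕ) (X Y z₀ : ℝ) {h : ℝ} (hh : 0 ≤ h) :
    Reachable a b (X, Y, z₀) (X, Y, z₀ - squareHolonomy a b X Y h) (4 * h) := by
  have right := reachable_of_hasDerivAt a b hh (x := fun t => X + t) (y := fun _ => Y)
    (d1 := fun _ => 1) (d2 := fun _ => 0) (by fun_prop) (by fun_prop)
    (fun t _ => by simpa using (hasDerivAt_id t).const_add X) (fun t _ => hasDerivAt_const _ _) z₀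
  have down := fun z₁ => reachable_of_hasDerivAt a b hh (x := fun _ => X + h) (y := fun t => Y - t)
    (d1 := fun _ => 0) (d2 := fun _ => -1) (by fun_prop) (by fun_prop)
    (fun t _ => hasDerivAt_const _ _) (fun t _ => by simpa using (hasDerivAt_id t).const_sub Y) z₁
  have left := fun z₁ => reachable_of_hasDerivAt a b hh (x := fun t => X + h - t)
    (y := fun _ => Y - h) (d1 := fun _ => -1) (d2 := fun _ => 0) (by fun_prop) (by fun_prop)
    (fun t _ => by simpa using (hasDerivAt_id t).const_sub (X + h))
    (fun t _ => hasDerivAt_const _ _) z₁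
  have up := fun z₁ => reachable_of_hasDerivAt a b hh (x := fun _ => X)
    (y := fun t => Y - (h - t)) (d1 := fun _ => 0) (d2 := fun _ => 1) (by fun_prop) (by fun_prop)
    (fun t _ => hasDerivAt_const _ _)
    (fun t _ => by simpa using ((hasDerivAt_id t).const_sub h).const_sub Y) z₁
  have hup : ∫ t in (0:ℝ)..h, (X ^ a - (Y - (h - t)) ^ b) ^ 2 =
      ∫ t in (0:ℝ)..h, (X ^ a - (Y - t) ^ b) ^ 2 := by
    rw [intervalIntegral.integral_comp_sub_left (fun t => (X ^ a - (Y - t) ^ b) ^ 2)]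
    simp
  simp at right down left up
  have := ((right.trans (down _)).trans (left _)).trans
    (by simpa using up _)
  convert this using 3
  · rw [squareHolonomy, intervalIntegral.integral_sub, hup]
    · ring
    · exact Continuous.intervalIntegrable (by fun_prop) _ _
    · exact Continuous.intervalIntegrable (by fun_prop) _ _
  · ring

lemma continuous_squareHolonomy (a b : ℕ) (X Y : ℝ) : Continuous (squareHolonomy a b X Y) := by
  unfold squareHolonomy
  exact intervalIntegral.continuous_parametric_intervalIntegral_of_continuous
    (f := fun h t => ((X + h) ^ a - (Y - t) ^ b) ^ 2 - (X ^ a - (Y - t) ^ b) ^ 2)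
    (by fun_prop) continuous_id

lemma le_squareHolonomy {a b : ℕ} (ha : a ≠ 0) {X Y h : ℝ} (hX : 0 ≤ X) (hXY : X ^ a = Y ^ b)
    (hh : 0 ≤ h) (hY : h ≤ Y) : (X ^ (a - 1)) ^ 2 * h ^ 3 ≤ squareHolonomy a b X Y h := by
  have hconst : (X ^ (a - 1)) ^ 2 * h ^ 3 = ∫ _ in (0:ℝ)..h, (X ^ (a - 1) * h) ^ 2 := by
    rw [intervalIntegral.integral_const]
    simp only [sub_zero, smul_eq_mul]
    ring
  rw [hconst]
  refine intervalIntegral.integral_mono_on hh (by simp)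
    (Continuous.intervalIntegrable (by fun_prop) _ _) fun t ht => ?_
  have h1 : X ^ a + X ^ (a - 1) * h ≤ (X + h) ^ a := by
    obtain ⟨n, rfl⟩ := Nat.exists_eq_succ_of_ne_zero ha
    have : X ^ n ≤ (X + h) ^ n := by gcongr; linarith
    simp only [Nat.succ_eq_add_one, Nat.add_sub_cancel, pow_succ]
    nlinarith
  have h2 : (Y - t) ^ b ≤ X ^ a := by
    rw [hXY]
    exact pow_le_pow_left₀ (by linarith [ht.2]) (by linarith [ht.1]) _
  have h3 : 0 ≤ X ^ (a - 1) * h := by positivity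
  nlinarith [mul_nonneg h3 (sub_nonneg.2 h2)]

/-- Quantitative convexity of `v ↦ √(1 + v²)`. -/
lemma sqrt_one_add_sq_ge {B m v : ℝ} (hm : 0 ≤ m) (hv : 0 ≤ v) (hmB : m + 1 ≤ B)
    (hvB : v + 1 ≤ B) :
    Real.sqrt (1 + m ^ 2) + m / Real.sqrt (1 + m ^ 2) * (v - m) + (v - m) ^ 2 / (2 * B ^ 3) ≤
      Real.sqrt (1 + v ^ 2) := by
  have hB : 1 ≤ B := by linarith
  set S := Real.sqrt (1 + m ^ 2)
  set R := Real.sqrt (1 + v ^ 2)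
  have hS2 : S ^ 2 = 1 + m ^ 2 := Real.sq_sqrt (by positivity)
  have hR2 : R ^ 2 = 1 + v ^ 2 := Real.sq_sqrt (by positivity)
  have hS : 0 < S := Real.sqrt_pos.2 (by positivity)
  have hR : 0 < R := Real.sqrt_pos.2 (by positivity)
  have hSB : S ≤ B := by
    rw [Real.sqrt_le_left (by linarith)]
    nlinarith
  have hRB : R ≤ B := by
    rw [Real.sqrt_le_left (by linarith)]
    nlinarith
  have hden : S * (S * R + (1 + m * v)) ≤ 2 * B ^ 3 := by
    have h1 : S * R ≤ B * B := by gcongr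
    have h2 : 1 + m * v ≤ B * B := by nlinarith
    calc S * (S * R + (1 + m * v)) ≤ B * (B * B + B * B) := by gcongr
      _ = 2 * B ^ 3 := by ring
  have hpos : 0 < S * (S * R + (1 + m * v)) := by positivity
  have hle : (v - m) ^ 2 / (2 * B ^ 3) ≤ (v - m) ^ 2 / (S * (S * R + (1 + m * v))) := by gcongr
  have heq : R = S + m / S * (v - m) + (v - m) ^ 2 / (S * (S * R + (1 + m * v))) := by
    have hne : S * R + (1 + m * v) ≠ 0 := by positivity
    have h1 : (v - m) ^ 2 = (S * R - (1 + m * v)) * (S * R + (1 + m * v)) := by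
      linear_combination (-R ^ 2) * hS2 - (1 + m ^ 2) * hR2
    rw [h1]
    field_simp
    linear_combination (-1 : ℝ) * hS2
  linarith

/-- Replacing the initial piece of the graph of `t ↦ t ^ β` by the chord saves a length of order
`δ ^ (2β - 1)`. -/
lemma chord_gain {β δ : ℝ} (hβ : 1 < β) (hδ : 0 < δ) (hδ1 : δ ≤ 1) :
    δ * Real.sqrt (1 + (δ ^ (β - 1)) ^ 2) +
        (β - 1) ^ 2 / (2 * β - 1) / (2 * (β + 1) ^ 3) * δ ^ (2 * β - 1) ≤
      ∫ t in (0:ℝ)..δ, Real.sqrt (1 + (β * t ^ (β - 1)) ^ 2) := by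
  set m := δ ^ (β - 1)
  set S := Real.sqrt (1 + m ^ 2)
  have hm0 : 0 ≤ m := by positivity
  have hm1 : m ≤ 1 := Real.rpow_le_one hδ.le hδ1 (by linarith)
  have hcont : Continuous fun t : ℝ => t ^ (β - 1) :=
    Real.continuous_rpow_const (by linarith)
  have hcont' : Continuous fun t : ℝ => t ^ (2 * β - 2) :=
    Real.continuous_rpow_const (by linarith)
  have e1 : ∫ t in (0:ℝ)..δ, t ^ (β - 1) = m * δ / β := by
    rw [integral_rpow (Or.inl (by linarith)), sub_add_cancel, Real.zero_rpow (by linarith),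
      ← Real.rpow_add_one hδ.ne', sub_add_cancel, sub_zero]
  have e2 : ∫ t in (0:ℝ)..δ, t ^ (2 * β - 2) = δ ^ (2 * β - 1) / (2 * β - 1) := by
    rw [integral_rpow (Or.inl (by linarith)), show 2 * β - 2 + 1 = 2 * β - 1 by ring,
      Real.zero_rpow (by linarith), sub_zero]
  have e3 : m ^ 2 * δ = δ ^ (2 * β - 1) := by
    rw [← Real.rpow_natCast, ← Real.rpow_mul hδ.le, ← Real.rpow_add_one hδ.ne']
    congr 1
    push_cast
    ring
  set D := 2 * (β + 1) ^ 3
  have hD : D ≠ 0 := by positivity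
  have hint : ∫ t in (0:ℝ)..δ, ((S - m / S * m + m ^ 2 / D) +
      ((m / S * β - 2 * m * β / D) * t ^ (β - 1) + β ^ 2 / D * t ^ (2 * β - 2))) =
      δ * S + (β - 1) ^ 2 / (2 * β - 1) / D * δ ^ (2 * β - 1) := by
    rw [intervalIntegral.integral_add (f := fun _ => S - m / S * m + m ^ 2 / D) (by simp)
        (Continuous.intervalIntegrable (by fun_prop) _ _), intervalIntegral.integral_const,
      intervalIntegral.integral_add (Continuous.intervalIntegrable (by fun_prop) _ _)
        (Continuous.intervalIntegrable (by fun_prop) _ _),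
      intervalIntegral.integral_const_mul, intervalIntegral.integral_const_mul, e1, e2,
      ← e3]
    have hβ0 : β ≠ 0 := by linarith
    have hS : S ≠ 0 := (Real.sqrt_pos.2 (by positivity)).ne'
    obtain ⟨q, hq⟩ : ∃ q, q = 2 * β - 1 := ⟨_, rfl⟩
    have hq0 : q ≠ 0 := by rw [hq]; linarith
    rw [← hq]
    simp only [sub_zero, smul_eq_mul]
    field_simp
    rw [hq]
    ring
  rw [← hint]
  refine intervalIntegral.integral_mono_on hδ.le
    (Continuous.intervalIntegrable (by fun_prop) _ _)
    (Continuous.intervalIntegrable (by fun_prop) _ _) fun t ht => ?_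
  have ht1 : t ^ (β - 1) ≤ 1 := Real.rpow_le_one ht.1 (ht.2.trans hδ1) (by linarith)
  have ht0 : 0 ≤ t ^ (β - 1) := Real.rpow_nonneg ht.1 _
  have hsq : t ^ (2 * β - 2) = (t ^ (β - 1)) ^ 2 := by
    rw [← Real.rpow_natCast, ← Real.rpow_mul ht.1]
    congr 1
    push_cast
    ring
  refine le_trans (le_of_eq ?_) (sqrt_one_add_sq_ge (B := β + 1) hm0
    (mul_nonneg (by linarith) ht0) (by linarith) (by nlinarith))
  rw [hsq]
  ring

/-- The vertical displacement along the chord is at most `δ ^ (2b + 1)`. -/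
lemma chord_integral_le {a b : ℕ} (hab : a ≤ b) {m δ : ℝ} (hδ : 0 ≤ δ) (hm0 : 0 ≤ m)
    (hm : m ^ a = δ ^ (b - a)) :
    ∫ t in (0:ℝ)..δ, ((m * t) ^ a - t ^ b) ^ 2 ≤ δ ^ (2 * b + 1) := by
  have hconst : δ ^ (2 * b + 1) = ∫ _ in (0:ℝ)..δ, (δ ^ b) ^ 2 := by
    rw [intervalIntegral.integral_const]
    simp only [sub_zero, smul_eq_mul]
    ring
  rw [hconst]
  refine intervalIntegral.integral_mono_on hδ (Continuous.intervalIntegrable (by fun_prop) _ _)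
    (by simp) fun t ht => ?_
  have h1 : (m * t) ^ a ≤ δ ^ b := by
    rw [mul_pow, hm, ← Nat.sub_add_cancel hab, pow_add, Nat.add_sub_cancel]
    have := pow_le_pow_left₀ ht.1 ht.2 a
    gcongr
  have h2 : t ^ b ≤ δ ^ b := pow_le_pow_left₀ ht.1 ht.2 b
  have h3 : 0 ≤ (m * t) ^ a := pow_nonneg (mul_nonneg hm0 ht.1) _
  have h4 : 0 ≤ t ^ b := pow_nonneg ht.1 _
  exact sq_le_sq' (by linarith) (by linarith)

lemma exists_small_parameter {r s c κ G ε : ℝ} (hr : 0 < r) (hsr : s < r) (hc : 0 < c)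
    (hκ : 0 < κ) (hG : 0 < G) (hε : 0 < ε) :
    ∃ δ : ℝ, 0 < δ ∧ δ ≤ 1 ∧ δ < ε ∧ δ ^ r < G ∧ c * δ ^ r < κ * δ ^ s := by
  have hlim : ∀ {p : ℝ}, 0 < p → Filter.Tendsto (fun δ : ℝ => δ ^ p) (nhdsWithin 0 (Ioi 0))
      (nhds 0) := fun {p} hp => by
    have := (Real.continuousAt_rpow_const 0 p (Or.inr hp.le)).tendsto
    rw [Real.zero_rpow hp.ne'] at this
    exact this.mono_left nhdsWithin_le_nhds
  have h1 := (hlim hr).eventually_lt_const hG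
  have h2 := (hlim (sub_pos.2 hsr)).eventually_lt_const (div_pos hκ hc)
  have h3 : ∀ᶠ δ : ℝ in nhdsWithin 0 (Ioi 0), δ ∈ Ioo 0 (min 1 ε) :=
    Ioo_mem_nhdsGT (by positivity)
  obtain ⟨δ, h1, h2, h3, h4⟩ := (h1.and (h2.and h3)).exists
  refine ⟨δ, h3, (h4.trans_le (min_le_left _ _)).le, h4.trans_le (min_le_right _ _), h1, ?_⟩
  rw [lt_div_iff₀ hc, Real.rpow_sub h3, div_mul_eq_mul_div, div_lt_iff₀ (by positivity)] at h2
  linarith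

/-- If `b > a ≥ 3` or `(a,b) = (2,3)`, then for every `ε > 0` the curve
`γ_ε(t) = (t^{b/a}, t, 0)` is not length-minimizing: there is a horizontal curve with the same
endpoints and strictly smaller length. -/
theorem gamma_not_minimizing (a b : ℕ)
    (hab : (3 ≤ a ∧ a < b) ∨ (a = 2 ∧ b = 3)) (ε : ℝ) (hε : 0 < ε) :
    ∃ τ : ℝ, 0 < τ ∧ ∃ η : HorizontalCurve a b τ,
      η.x 0 = 0 ∧ η.y 0 = 0 ∧ η.z 0 = 0 ∧
      η.x τ = ε ^ ((b : ℝ) / a) ∧ η.y τ = ε ∧ η.z τ = 0 ∧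
      η.length < ∫ t in (0:ℝ)..ε,
        Real.sqrt (1 + ((b : ℝ) / a) ^ 2 * t ^ (2 * ((b : ℝ) / a) - 2)) := by
  have ha : 0 < a := by omega
  have hlt : a < b := by omega
  have haR : (0 : ℝ) < a := by exact_mod_cast ha
  have hexp : 3 * b < a * (b + 2) := by
    rcases hab with ⟨h3, _⟩ | ⟨rfl, rfl⟩
    · nlinarith
    · norm_num
  set β : ℝ := (b : ℝ) / a with hβdef
  have hβ : 1 < β := by
    rw [hβdef, one_lt_div haR]
    exact_mod_cast hlt
  have hβa : β * a = b := div_mul_cancel₀ _ haR.ne'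
  have hpow : ∀ t : ℝ, 0 ≤ t → (t ^ β) ^ a = t ^ b := fun t ht => by
    rw [← Real.rpow_natCast, ← Real.rpow_mul ht, hβa, Real.rpow_natCast]
  have hX : 0 < ε ^ β := by positivity
  set X := ε ^ β
  have hc : 0 < (X ^ (a - 1)) ^ 2 := by positivity
  set c := (X ^ (a - 1)) ^ 2 with hcdef
  have hG : 0 < squareHolonomy a b X ε ε :=
    lt_of_lt_of_le (by positivity)
      (le_squareHolonomy ha.ne' hX.le (hpow ε hε.le) hε.le le_rfl)
  set κ := (β - 1) ^ 2 / (2 * β - 1) / (2 * (β + 1) ^ 3)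
  have hκ : 0 < κ := by
    have : 0 < β - 1 := by linarith
    have : 0 < 2 * β - 1 := by linarith
    positivity
  have hsr : (2 * β - 1) * (3 : ℕ) < ((2 * b + 1 : ℕ) : ℝ) := by
    have : (3 * b : ℝ) < a * (b + 2) := by exact_mod_cast hexp
    have h3 : 3 * β < b + 2 := by
      rw [hβdef, ← mul_div_assoc, div_lt_iff₀ haR]
      linarith
    push_cast
    linarith
  obtain ⟨δ, hδ, hδ1, hδε, hδG, hδκ⟩ := exists_small_parameter
    (r := ((2 * b + 1 : ℕ) : ℝ)) (by positivity) hsr (c := 64 / c) (κ := κ ^ 3)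
    (by positivity) (by positivity) hG hε
  rw [Real.rpow_mul hδ.le, Real.rpow_natCast, Real.rpow_natCast, ← mul_pow] at hδκ
  rw [Real.rpow_natCast] at hδG
  set m := δ ^ (β - 1) with hmdef
  have hm0 : 0 < m := by positivity
  have hmδ : m * δ = δ ^ β := by
    rw [hmdef, ← Real.rpow_add_one hδ.ne', sub_add_cancel]
  have hma : m ^ a = δ ^ (b - a) := by
    rw [← Real.rpow_natCast, hmdef, ← Real.rpow_mul hδ.le, sub_mul, hβa, one_mul,
      ← Nat.cast_sub hlt.le, Real.rpow_natCast]
  set E := ∫ t in (0:ℝ)..δ, ((m * t) ^ a - t ^ b) ^ 2 with hEdef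
  have hE : E ≤ δ ^ (2 * b + 1) := chord_integral_le hlt.le hδ.le hm0.le hma
  have hE0 : 0 ≤ E := intervalIntegral.integral_nonneg hδ.le fun t _ => sq_nonneg _
  obtain ⟨h, ⟨hh0, hhε⟩, hhE⟩ : E ∈ squareHolonomy a b X ε '' Icc 0 ε :=
    intermediate_value_Icc hε.le (continuous_squareHolonomy a b X ε).continuousOn
      ⟨by simpa [squareHolonomy] using hE0, (hE.trans_lt hδG).le⟩
  have hsmall : 4 * h < κ * δ ^ (2 * β - 1) := by
    refine lt_of_pow_lt_pow_left₀ 3 (by positivity) (lt_of_le_of_lt ?_ hδκ)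
    have h1 := le_squareHolonomy ha.ne' hX.le (hpow ε hε.le) hh0 hhε
    rw [hhE, ← hcdef] at h1
    rw [div_mul_eq_mul_div, le_div_iff₀ hc]
    nlinarith
  have chord := reachable_of_hasDerivAt a b hδ.le (x := fun t => m * t) (y := fun t => t)
    (d1 := fun _ => m) (d2 := fun _ => 1) (by fun_prop) (by fun_prop)
    (fun t _ => by simpa using (hasDerivAt_id t).const_mul m) (fun t _ => hasDerivAt_id t) 0
  have hcont : Continuous fun t : ℝ => t ^ (β - 1) :=
    Real.continuous_rpow_const (by linarith)
  have graph := reachable_of_hasDerivAt a b hδε.le (x := fun t => t ^ β) (y := fun t => t)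
    (d1 := fun t => β * t ^ (β - 1)) (d2 := fun _ => 1) (by fun_prop) (by fun_prop)
    (fun t _ => Real.hasDerivAt_rpow_const (Or.inr hβ.le)) (fun t _ => hasDerivAt_id t) E
  have hgraph : ∫ t in δ..ε, (1 : ℝ) * ((t ^ β) ^ a - t ^ b) ^ 2 = 0 := by
    rw [← intervalIntegral.integral_zero (a := δ) (b := ε) (μ := volume)]
    refine intervalIntegral.integral_congr fun t ht => ?_
    rw [uIcc_of_le hδε.le] at ht
    simp [hpow t (hδ.le.trans ht.1)]
  rw [hgraph, add_zero] at graph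
  simp only [one_mul, mul_zero, zero_add, ← hEdef, hmδ, intervalIntegral.integral_const,
    sub_zero, smul_eq_mul] at chord
  have square := reachable_square a b X ε E hh0
  rw [hhE, sub_self] at square
  obtain ⟨τ, hτ, η, h0, h1, hL, -, -⟩ := (chord.trans graph).trans square
  simp only [Prod.mk.injEq] at h0 h1
  refine ⟨τ, hτ.lt_of_ne ?_, η, h0.1, h0.2.1, h0.2.2, h1.1, h1.2.1, h1.2.2, ?_⟩
  · rintro rfl
    linarith [h0.2.1, h1.2.1]
  have hF : ∫ t in (0:ℝ)..ε, Real.sqrt (1 + β ^ 2 * t ^ (2 * β - 2)) =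
      ∫ t in (0:ℝ)..ε, Real.sqrt (1 + (β * t ^ (β - 1)) ^ 2) := by
    refine intervalIntegral.integral_congr fun t ht => ?_
    rw [uIcc_of_le hε.le] at ht
    have : t ^ (2 * β - 2) = (t ^ (β - 1)) ^ 2 := by
      rw [← Real.rpow_natCast, ← Real.rpow_mul ht.1]
      congr 1
      push_cast
      ring
    simp only [this, mul_pow]
  have hsplit := intervalIntegral.integral_add_adjacent_intervals (μ := volume)
    (a := 0) (b := δ) (c := ε) (f := fun t => Real.sqrt (1 + (β * t ^ (β - 1)) ^ 2))
    (Continuous.intervalIntegrable (by fun_prop) _ _)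
    (Continuous.intervalIntegrable (by fun_prop) _ _)
  have hgain := chord_gain hβ hδ hδ1
  change δ * Real.sqrt (1 + m ^ 2) + κ * δ ^ (2 * β - 1) ≤ _ at hgain
  simp only [one_pow, add_comm _ (1 : ℝ)] at hL
  rw [hL, hF, ← hsplit]
  linarith
end

section
/- Let a, b be natural numbers with either a > b ≥ 3, or (a,b) = (3,2). Then for every ε > 0 the curve γ_ε : [0,ε] → ℝ³, γ_ε(t) = (t, t^{a/b}, 0) (real power), is NOT length-minimizing: there exist τ > 0 and a horizontal curve η̃ : [0,τ] → ℝ³ with η̃(0) = (0,0,0), η̃(τ) = (ε, ε^{a/b}, 0), and L(η̃) < L(γ_ε) = ∫₀^ε √(1 + (a/b)² t^{2(a/b)−2}) dt. -/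
open MeasureTheory Set

/-- Run `f` on `(-∞, τ]`, then `g` translated so as to start at `τ`. -/
noncomputable def glue (τ : ℝ) (f g : ℝ → ℝ) (t : ℝ) : ℝ :=
  if t ≤ τ then f t else g (t - τ)

theorem glue_of_le {τ t : ℝ} (f g : ℝ → ℝ) (h : t ≤ τ) : glue τ f g t = f t := if_pos h

theorem glue_of_lt {τ t : ℝ} (f g : ℝ → ℝ) (h : τ < t) : glue τ f g t = g (t - τ) :=
  if_neg h.not_ge

theorem intervalIntegrable_glue {τ σ : ℝ} (hτ : 0 ≤ τ) (hσ : 0 ≤ σ) {f g : ℝ → ℝ}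
    (hf : IntervalIntegrable f volume 0 τ) (hg : IntervalIntegrable g volume 0 σ) :
    IntervalIntegrable (glue τ f g) volume 0 (τ + σ) := by
  have h1 : IntervalIntegrable (glue τ f g) volume 0 τ := by
    refine hf.congr fun t ht => ?_
    rw [uIoc_of_le hτ] at ht
    exact (glue_of_le f g ht.2).symm
  have h2 : IntervalIntegrable (glue τ f g) volume τ (τ + σ) := by
    have h3 := hg.comp_sub_right τ
    rw [zero_add, add_comm σ] at h3
    refine h3.congr fun t ht => ?_
    rw [uIoc_of_le (by linarith)] at ht
    exact (glue_of_lt f g ht.1).symm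
  exact h1.trans h2

theorem integral_glue_of_le {τ t : ℝ} (f g : ℝ → ℝ) (ht0 : 0 ≤ t) (ht : t ≤ τ) :
    ∫ s in (0:ℝ)..t, glue τ f g s = ∫ s in (0:ℝ)..t, f s := by
  refine intervalIntegral.integral_congr fun s hs => ?_
  rw [uIcc_of_le ht0] at hs
  exact glue_of_le f g (hs.2.trans ht)

theorem integral_glue {τ σ t : ℝ} (hτ : 0 ≤ τ) {f g : ℝ → ℝ}
    (hf : IntervalIntegrable f volume 0 τ) (hg : IntervalIntegrable g volume 0 σ)
    (ht : τ ≤ t) (ht' : t ≤ τ + σ) :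
    ∫ s in (0:ℝ)..t, glue τ f g s =
      (∫ s in (0:ℝ)..τ, f s) + ∫ s in (0:ℝ)..(t - τ), g s := by
  have hi := intervalIntegrable_glue hτ (by linarith : 0 ≤ σ) hf hg
  have h1 : IntervalIntegrable (glue τ f g) volume 0 τ := by
    refine hi.mono_set ?_
    rw [uIcc_of_le hτ, uIcc_of_le (by linarith)]
    exact Icc_subset_Icc le_rfl (by linarith)
  have h2 : IntervalIntegrable (glue τ f g) volume τ t := by
    refine hi.mono_set ?_
    rw [uIcc_of_le ht, uIcc_of_le (by linarith)]
    exact Icc_subset_Icc hτ ht'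
  rw [← intervalIntegral.integral_add_adjacent_intervals h1 h2,
    integral_glue_of_le f g hτ le_rfl]
  congr 1
  have h3 : ∫ s in τ..t, glue τ f g s = ∫ s in τ..t, g (s - τ) := by
    refine intervalIntegral.integral_congr_ae (Filter.Eventually.of_forall fun s hs => ?_)
    rw [uIoc_of_le ht] at hs
    exact glue_of_lt f g hs.1
  rw [h3, intervalIntegral.integral_comp_sub_right (fun s => g s), sub_self]

/-- A primitive relation is preserved by gluing when the endpoint values match. -/
theorem glue_eq_add_integral {τ σ : ℝ} (hτ : 0 ≤ τ) {f g F G : ℝ → ℝ}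
    (hf : IntervalIntegrable f volume 0 τ) (hg : IntervalIntegrable g volume 0 σ)
    (hF : ∀ t ∈ Icc (0:ℝ) τ, F t = F 0 + ∫ s in (0:ℝ)..t, f s)
    (hG : ∀ t ∈ Icc (0:ℝ) σ, G t = G 0 + ∫ s in (0:ℝ)..t, g s) (hFG : F τ = G 0) :
    ∀ t ∈ Icc (0:ℝ) (τ + σ),
      glue τ F G t = glue τ F G 0 + ∫ s in (0:ℝ)..t, glue τ f g s := by
  intro t ht
  rw [glue_of_le F G hτ]
  rcases le_or_gt t τ with h | h
  · rw [glue_of_le F G h, integral_glue_of_le f g ht.1 h, hF t ⟨ht.1, h⟩]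
  · rw [glue_of_lt F G h, integral_glue hτ hf hg h.le ht.2,
      hG (t - τ) ⟨by linarith, by linarith [ht.2]⟩, ← hFG, hF τ ⟨hτ, le_rfl⟩, add_assoc]

/-- The point `(x₁,y₁,z₁)` is joined to `(x₀,y₀,z₀)` by a horizontal curve of length `L`. -/
def Reach (a b : ℕ) (x₀ y₀ z₀ x₁ y₁ z₁ L : ℝ) : Prop :=
  ∃ τ : ℝ, 0 < τ ∧ ∃ η : HorizontalCurve a b τ,
    η.x 0 = x₀ ∧ η.y 0 = y₀ ∧ η.z 0 = z₀ ∧ η.x τ = x₁ ∧ η.y τ = y₁ ∧ η.z τ = z₁ ∧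
    η.length = L ∧
    IntervalIntegrable (fun s => η.d2 s * ((η.x s) ^ a - (η.y s) ^ b) ^ 2) volume 0 τ ∧
    IntervalIntegrable (fun s => Real.sqrt (η.d1 s ^ 2 + η.d2 s ^ 2)) volume 0 τ

theorem Reach.trans {a b : ℕ} {x₀ y₀ z₀ x₁ y₁ z₁ x₂ y₂ z₂ L M : ℝ}
    (h : Reach a b x₀ y₀ z₀ x₁ y₁ z₁ L) (h' : Reach a b x₁ y₁ z₁ x₂ y₂ z₂ M) :
    Reach a b x₀ y₀ z₀ x₂ y₂ z₂ (L + M) := by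
  obtain ⟨τ, hτ, η, hx0, hy0, hz0, hx1, hy1, hz1, hL, hiz, hil⟩ := h
  obtain ⟨σ, hσ, θ, kx0, ky0, kz0, kx1, ky1, kz1, kL, kiz, kil⟩ := h'
  have ez : (fun s => glue τ η.d2 θ.d2 s * ((glue τ η.x θ.x s) ^ a - (glue τ η.y θ.y s) ^ b) ^ 2)
      = glue τ (fun s => η.d2 s * ((η.x s) ^ a - (η.y s) ^ b) ^ 2)
          (fun s => θ.d2 s * ((θ.x s) ^ a - (θ.y s) ^ b) ^ 2) := by
    funext s
    unfold glue
    split_ifs <;> rfl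
  have el : (fun s => Real.sqrt (glue τ η.d1 θ.d1 s ^ 2 + glue τ η.d2 θ.d2 s ^ 2))
      = glue τ (fun s => Real.sqrt (η.d1 s ^ 2 + η.d2 s ^ 2))
          (fun s => Real.sqrt (θ.d1 s ^ 2 + θ.d2 s ^ 2)) := by
    funext s
    unfold glue
    split_ifs <;> rfl
  have hend : τ < τ + σ := by linarith
  refine ⟨τ + σ, by linarith,
    { x := glue τ η.x θ.x
      y := glue τ η.y θ.y
      z := glue τ η.z θ.z
      d1 := glue τ η.d1 θ.d1
      d2 := glue τ η.d2 θ.d2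
      hd1 := intervalIntegrable_glue hτ.le hσ.le η.hd1 θ.hd1
      hd2 := intervalIntegrable_glue hτ.le hσ.le η.hd2 θ.hd2
      hx := glue_eq_add_integral hτ.le η.hd1 θ.hd1 η.hx θ.hx (hx1.trans kx0.symm)
      hy := glue_eq_add_integral hτ.le η.hd2 θ.hd2 η.hy θ.hy (hy1.trans ky0.symm)
      hz := by
        rw [ez]
        exact glue_eq_add_integral hτ.le hiz kiz η.hz θ.hz (hz1.trans kz0.symm) }, ?_⟩
  refine ⟨(glue_of_le _ _ hτ.le).trans hx0, (glue_of_le _ _ hτ.le).trans hy0,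
    (glue_of_le _ _ hτ.le).trans hz0, ?_, ?_, ?_, ?_, ?_, ?_⟩
  · simpa only [glue_of_lt _ _ hend, add_sub_cancel_left] using kx1
  · simpa only [glue_of_lt _ _ hend, add_sub_cancel_left] using ky1
  · simpa only [glue_of_lt _ _ hend, add_sub_cancel_left] using kz1
  · rw [← hL, ← kL]
    unfold HorizontalCurve.length
    dsimp only
    rw [el, integral_glue hτ.le hil kil hend.le le_rfl, add_sub_cancel_left]
  · dsimp only
    rw [ez]
    exact intervalIntegrable_glue hτ.le hσ.le hiz kiz
  · dsimp only
    rw [el]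
    exact intervalIntegrable_glue hτ.le hσ.le hil kil

/-- Horizontal lift of a straight segment. -/
theorem reach_segment (a b : ℕ) (x₀ y₀ z₀ x₁ y₁ : ℝ) :
    Reach a b x₀ y₀ z₀ x₁ y₁
      (z₀ + ∫ s in (0:ℝ)..1,
        (y₁ - y₀) * ((x₀ + s * (x₁ - x₀)) ^ a - (y₀ + s * (y₁ - y₀)) ^ b) ^ 2)
      (Real.sqrt ((x₁ - x₀) ^ 2 + (y₁ - y₀) ^ 2)) := by
  refine ⟨1, one_pos,
    { x := fun s => x₀ + s * (x₁ - x₀)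
      y := fun s => y₀ + s * (y₁ - y₀)
      z := fun t => z₀ + ∫ s in (0:ℝ)..t,
        (y₁ - y₀) * ((x₀ + s * (x₁ - x₀)) ^ a - (y₀ + s * (y₁ - y₀)) ^ b) ^ 2
      d1 := fun _ => x₁ - x₀
      d2 := fun _ => y₁ - y₀
      hd1 := by simp
      hd2 := by simp
      hx := fun t _ => by simp only [intervalIntegral.integral_const, smul_eq_mul]; ring
      hy := fun t _ => by simp only [intervalIntegral.integral_const, smul_eq_mul]; ring
      hz := by simp }, ?_⟩
  refine ⟨by simp, by simp, by simp, by simp, by simp, rfl, ?_, ?_, by simp⟩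
  · simp [HorizontalCurve.length]
  · exact Continuous.intervalIntegrable (by fun_prop) _ _

theorem continuous_speed {r : ℝ} (hr : 1 < r) :
    Continuous fun t : ℝ => Real.sqrt (1 + r ^ 2 * t ^ (2 * r - 2)) := by
  have := Real.continuous_rpow_const (q := 2 * r - 2) (by linarith)
  fun_prop

/-- The arc of `y = x^{a/b}` lifts to a curve of constant third coordinate. -/
theorem reach_arc {a b : ℕ} (hb : 0 < b) (hab : b < a) {δ ε : ℝ} (hδ : 0 < δ) (hε : δ < ε)
    (z₀ : ℝ) :
    Reach a b δ (δ ^ ((a : ℝ) / b)) z₀ ε (ε ^ ((a : ℝ) / b)) z₀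
      (∫ t in δ..ε, Real.sqrt (1 + ((a : ℝ) / b) ^ 2 * t ^ (2 * ((a : ℝ) / b) - 2))) := by
  have hb' : (0 : ℝ) < b := by exact_mod_cast hb
  have hr : 1 < (a : ℝ) / b := by
    rw [one_lt_div hb']
    exact_mod_cast hab
  have hP : ∀ t : ℝ, 0 ≤ t → t ^ a - (t ^ ((a : ℝ) / b)) ^ b = 0 := by
    intro t ht
    rw [← Real.rpow_natCast (t ^ _) b, ← Real.rpow_mul ht, div_mul_cancel₀ _ hb'.ne',
      Real.rpow_natCast, sub_self]
  have hc := Real.continuous_rpow_const (q := (a : ℝ) / b - 1) (by linarith)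
  have hs := continuous_speed hr
  set r := (a : ℝ) / b with hrdef
  have hd : Continuous fun s : ℝ => r * (s + δ) ^ (r - 1) := by fun_prop
  have hzero : ∀ t ∈ Icc (0:ℝ) (ε - δ), ∀ s ∈ uIcc (0:ℝ) t,
      r * (s + δ) ^ (r - 1) * ((s + δ) ^ a - ((s + δ) ^ r) ^ b) ^ 2 = 0 := by
    intro t ht s hs
    rw [uIcc_of_le ht.1] at hs
    rw [hP _ (by linarith [hs.1])]
    simp
  have hmem : ε - δ ∈ Icc (0:ℝ) (ε - δ) := ⟨by linarith, le_rfl⟩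
  have hspeed : ∀ s ∈ uIcc (0:ℝ) (ε - δ),
      Real.sqrt (1 ^ 2 + (r * (s + δ) ^ (r - 1)) ^ 2)
        = Real.sqrt (1 + r ^ 2 * (s + δ) ^ (2 * r - 2)) := by
    intro s hs
    rw [uIcc_of_le hmem.1] at hs
    have h0 : 0 ≤ s + δ := by linarith [hs.1]
    rw [one_pow, mul_pow, ← Real.rpow_natCast ((s + δ) ^ (r - 1)) 2, ← Real.rpow_mul h0]
    congr 4
    push_cast
    ring
  refine ⟨ε - δ, by linarith,
    { x := fun s => s + δ
      y := fun s => (s + δ) ^ r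
      z := fun _ => z₀
      d1 := fun _ => 1
      d2 := fun s => r * (s + δ) ^ (r - 1)
      hd1 := by simp
      hd2 := hd.intervalIntegrable _ _
      hx := fun t _ => by simp [add_comm]
      hy := fun t _ => by
        rw [intervalIntegral.integral_eq_sub_of_hasDerivAt (f := fun s => (s + δ) ^ r) _
          (hd.intervalIntegrable _ _)]
        · ring
        · intro s _
          simpa using ((hasDerivAt_id s).add_const δ).rpow_const (p := r) (Or.inr hr.le)
      hz := fun t ht => by
        rw [intervalIntegral.integral_congr (g := fun _ => (0:ℝ)) (hzero t ht)]
        simp }, ?_⟩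
  refine ⟨by simp, by simp, rfl, by simp, by simp, rfl, ?_, ?_, ?_⟩
  · unfold HorizontalCurve.length
    dsimp only
    rw [intervalIntegral.integral_congr hspeed,
      intervalIntegral.integral_comp_add_right
        (fun t => Real.sqrt (1 + r ^ 2 * t ^ (2 * r - 2))), zero_add, sub_add_cancel]
  · dsimp only
    refine (intervalIntegrable_const (c := (0:ℝ))).congr fun s hs => ?_
    exact (hzero _ hmem s (uIoc_subset_uIcc hs)).symm
  · dsimp only
    refine Continuous.intervalIntegrable ?_ _ _
    fun_prop

/-- A small rectangle with corner `(ε, Y)` on the curve `P = 0`, run clockwise, lowers the third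
coordinate by a prescribed amount `K`, provided `K` is at most cubic in the side `u`. -/
theorem reach_rectangle {a b : ℕ} (ha : 1 ≤ a) {ε Y u K : ℝ} (hε : 0 < ε)
    (hY : Y ^ b = ε ^ a) (hu : 0 < u) (huY : u ≤ Y) (hK : 0 ≤ K)
    (hKu : K ≤ (ε ^ (a - 1)) ^ 2 * u ^ 3) :
    ∃ L ≤ 4 * u, Reach a b ε Y K ε Y 0 L := by
  set F : ℝ → ℝ := fun v => ∫ s in (0:ℝ)..1,
    (v * ((ε + u) ^ a - (Y - v * s) ^ b) ^ 2 - v * (ε ^ a - (Y - v * s) ^ b) ^ 2) with hF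
  have hFc : Continuous F :=
    intervalIntegral.continuous_parametric_intervalIntegral_of_continuous' (by fun_prop) 0 1
  have hpow : ε ^ a + ε ^ (a - 1) * u ≤ (ε + u) ^ a := by
    obtain ⟨n, rfl⟩ : ∃ n, a = n + 1 := ⟨a - 1, by omega⟩
    rw [Nat.add_sub_cancel, pow_succ, pow_succ, ← mul_add]
    gcongr
    linarith
  have hpu : 0 < ε ^ (a - 1) * u := by positivity
  have hFu : (ε ^ (a - 1)) ^ 2 * u ^ 3 ≤ F u := by
    have : ∫ _ in (0:ℝ)..1, (ε ^ (a - 1)) ^ 2 * u ^ 3 ≤ F u := by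
      refine intervalIntegral.integral_mono_on zero_le_one (by simp)
        (Continuous.intervalIntegrable (by fun_prop) _ _) fun s hs => ?_
      have h0 : 0 ≤ Y - u * s := by nlinarith [hs.2]
      have h1 : (Y - u * s) ^ b ≤ ε ^ a := by
        rw [← hY]
        exact pow_le_pow_left₀ h0 (by nlinarith [hs.1]) b
      have h2 : (ε ^ (a - 1) * u) ^ 2 ≤
          ((ε + u) ^ a - (Y - u * s) ^ b) ^ 2 - (ε ^ a - (Y - u * s) ^ b) ^ 2 := by
        nlinarith
      calc (ε ^ (a - 1)) ^ 2 * u ^ 3 = u * (ε ^ (a - 1) * u) ^ 2 := by ring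
        _ ≤ _ := by
          rw [← mul_sub]
          gcongr
    simpa using this
  obtain ⟨v, ⟨hv0, hvu⟩, hv⟩ : K ∈ F '' Icc 0 u :=
    intermediate_value_Icc hu.le hFc.continuousOn ⟨by simpa [hF] using hK, hKu.trans hFu⟩
  have h := (((reach_segment a b ε Y K (ε + u) Y).trans
    (reach_segment a b _ _ _ (ε + u) (Y - v))).trans
    (reach_segment a b _ _ _ ε (Y - v))).trans (reach_segment a b _ _ _ ε Y)
  have hup : ∫ s in (0:ℝ)..1, v * (ε ^ a - (Y - v + s * v) ^ b) ^ 2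
      = ∫ s in (0:ℝ)..1, v * (ε ^ a - (Y - v * s) ^ b) ^ 2 := by
    have h := intervalIntegral.integral_comp_sub_left (a := 0) (b := 1)
      (fun s => v * (ε ^ a - (Y - v * s) ^ b) ^ 2) 1
    rw [sub_self, sub_zero] at h
    rw [← h]
    congr 1
    funext s
    ring_nf
  have hdown : ∫ s in (0:ℝ)..1, (-v) * ((ε + u) ^ a - (Y + s * (-v)) ^ b) ^ 2
      = - ∫ s in (0:ℝ)..1, v * ((ε + u) ^ a - (Y - v * s) ^ b) ^ 2 := by
    rw [← intervalIntegral.integral_neg]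
    congr 1
    funext s
    ring_nf
  have hsplit : F v = (∫ s in (0:ℝ)..1, v * ((ε + u) ^ a - (Y - v * s) ^ b) ^ 2)
      - ∫ s in (0:ℝ)..1, v * (ε ^ a - (Y - v * s) ^ b) ^ 2 :=
    intervalIntegral.integral_sub (Continuous.intervalIntegrable (by fun_prop) _ _)
      (Continuous.intervalIntegrable (by fun_prop) _ _)
  have e1 : Y - v - Y = -v := by ring
  have e2 : Y - (Y - v) = v := by ring
  have e3 : ε - (ε + u) = -u := by ring
  have e4 : (0 : ℝ) ^ 2 = 0 := by norm_num
  simp only [e1, e2, e3, e4, add_sub_cancel_left, sub_self, zero_mul, mul_zero,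
    intervalIntegral.integral_zero, add_zero, zero_add, neg_sq, Real.sqrt_sq hu.le,
    Real.sqrt_sq hv0] at h
  rw [hup, hdown, ← hv, hsplit] at h
  refine ⟨u + v + u + v, by linarith, ?_⟩
  convert h using 1 <;> linarith

/-- The chord of `y = x^r` over `[0,δ]` is shorter than the arc by at least a multiple of
`δ^{2r-1}`. -/
theorem chord_add_le_arc {r δ : ℝ} (hr : 1 < r) (hδ : 0 < δ)
    (hsmall : r ^ 2 * δ ^ (2 * r - 2) ≤ 2 * (r - 1) ^ 2 / r ^ 2) :
    Real.sqrt (δ ^ 2 + (δ ^ r) ^ 2) + (r - 1) ^ 2 / (4 * (2 * r - 1)) * δ ^ (2 * r - 1) ≤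
      ∫ t in (0:ℝ)..δ, Real.sqrt (1 + r ^ 2 * t ^ (2 * r - 2)) := by
  have hr0 : 0 < r := by linarith
  have h2r : 0 < 2 * r - 1 := by linarith
  set κ := 1 - (r - 1) ^ 2 / (2 * r ^ 2) with hκ
  have hκ1 : κ ≤ 1 := by
    have : 0 ≤ (r - 1) ^ 2 / (2 * r ^ 2) := by positivity
    linarith
  have hκ0 : 0 ≤ κ := by
    have : (r - 1) ^ 2 / (2 * r ^ 2) ≤ 1 := by
      rw [div_le_one (by positivity)]
      nlinarith
    linarith
  have hcont := Real.continuous_rpow_const (q := 2 * r - 2) (by linarith)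
  have hchord : Real.sqrt (δ ^ 2 + (δ ^ r) ^ 2) ≤ δ + δ ^ (2 * r - 1) / 2 := by
    have h1 : (δ ^ r) ^ 2 = δ * δ ^ (2 * r - 1) := by
      rw [← Real.rpow_one_add' hδ.le (by linarith), ← Real.rpow_natCast, ← Real.rpow_mul hδ.le]
      congr 1
      push_cast
      ring
    rw [h1]
    have : 0 < δ ^ (2 * r - 1) := by positivity
    refine Real.sqrt_le_iff.2 ⟨by positivity, by nlinarith⟩
  have harc : δ + κ * r ^ 2 / 2 * (δ ^ (2 * r - 1) / (2 * r - 1)) ≤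
      ∫ t in (0:ℝ)..δ, Real.sqrt (1 + r ^ 2 * t ^ (2 * r - 2)) := by
    have hle : ∫ t in (0:ℝ)..δ, (1 + κ * r ^ 2 / 2 * t ^ (2 * r - 2)) ≤
        ∫ t in (0:ℝ)..δ, Real.sqrt (1 + r ^ 2 * t ^ (2 * r - 2)) := by
      refine intervalIntegral.integral_mono_on hδ.le
        (Continuous.intervalIntegrable (by fun_prop) _ _)
        ((continuous_speed hr).intervalIntegrable _ _) fun t ht => ?_
      have hS0 : 0 ≤ t ^ (2 * r - 2) := Real.rpow_nonneg ht.1 _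
      have hSle : t ^ (2 * r - 2) ≤ δ ^ (2 * r - 2) :=
        Real.rpow_le_rpow ht.1 ht.2 (by linarith)
      have hs : r ^ 2 * t ^ (2 * r - 2) ≤ 4 * (1 - κ) := by
        calc r ^ 2 * t ^ (2 * r - 2) ≤ r ^ 2 * δ ^ (2 * r - 2) := by gcongr
          _ ≤ 2 * (r - 1) ^ 2 / r ^ 2 := hsmall
          _ = 4 * (1 - κ) := by
            rw [hκ]
            field_simp
            ring
      have hs0 : 0 ≤ r ^ 2 * t ^ (2 * r - 2) := by positivity
      generalize hS : r ^ 2 * t ^ (2 * r - 2) = S at hs hs0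
      rw [show κ * r ^ 2 / 2 * t ^ (2 * r - 2) = κ * S / 2 by rw [← hS]; ring]
      refine Real.le_sqrt_of_sq_le ?_
      have h1 : κ ^ 2 * S ≤ S := by
        have : κ ^ 2 ≤ 1 := by nlinarith
        nlinarith
      nlinarith [mul_le_mul_of_nonneg_left (h1.trans hs) hs0]
    refine le_trans (le_of_eq ?_) hle
    rw [intervalIntegral.integral_add (by simp)
      (Continuous.intervalIntegrable (by fun_prop) _ _), intervalIntegral.integral_const_mul,
      integral_rpow (Or.inl (by linarith)), Real.zero_rpow (by linarith)]
    rw [show 2 * r - 2 + 1 = 2 * r - 1 by ring]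
    simp
  refine le_trans ?_ harc
  have hκr : κ * r ^ 2 / 2 * (δ ^ (2 * r - 1) / (2 * r - 1)) =
      δ ^ (2 * r - 1) / 2 + (r - 1) ^ 2 / (4 * (2 * r - 1)) * δ ^ (2 * r - 1) := by
    have h1 : κ * r ^ 2 = (r - 1) ^ 2 / 2 + (2 * r - 1) := by
      rw [hκ]
      field_simp
      ring
    rw [h1]
    generalize δ ^ (2 * r - 1) = D
    generalize 2 * r - 1 = q at h2r ⊢
    field_simp
    ring
  linarith

/-- The chord of `P = 0` over `[0,δ]` raises the third coordinate by at most `δ^{2a+a/b}`. -/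
theorem reach_chord {a b : ℕ} (hb : 0 < b) {δ : ℝ} (hδ : 0 < δ) :
    ∃ K, 0 ≤ K ∧ K ≤ δ ^ (2 * (a : ℝ) + (a : ℝ) / b) ∧
      Reach a b 0 0 0 δ (δ ^ ((a : ℝ) / b)) K
        (Real.sqrt (δ ^ 2 + (δ ^ ((a : ℝ) / b)) ^ 2)) := by
  have hb' : (b : ℝ) ≠ 0 := by exact_mod_cast hb.ne'
  have hY : (δ ^ ((a : ℝ) / b)) ^ b = δ ^ a := by
    rw [← Real.rpow_natCast (δ ^ _) b, ← Real.rpow_mul hδ.le, div_mul_cancel₀ _ hb',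
      Real.rpow_natCast]
  have hY0 : 0 < δ ^ ((a : ℝ) / b) := by positivity
  have h := reach_segment a b 0 0 0 δ (δ ^ ((a : ℝ) / b))
  have hexp : δ ^ (2 * (a : ℝ) + (a : ℝ) / b) = δ ^ ((a : ℝ) / b) * (δ ^ a) ^ 2 := by
    rw [Real.rpow_add hδ, mul_comm (2 : ℝ), Real.rpow_mul hδ.le, Real.rpow_natCast, mul_comm]
    norm_cast
  rw [hexp]
  generalize δ ^ ((a : ℝ) / b) = Y at *
  simp only [sub_zero, zero_add] at h
  refine ⟨_, ?_, ?_, h⟩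
  · exact intervalIntegral.integral_nonneg zero_le_one fun s _ => by positivity
  · have : ∫ s in (0:ℝ)..1, Y * ((s * δ) ^ a - (s * Y) ^ b) ^ 2 ≤
        ∫ _ in (0:ℝ)..1, Y * (δ ^ a) ^ 2 := by
      refine intervalIntegral.integral_mono_on zero_le_one
        (Continuous.intervalIntegrable (by fun_prop) _ _) (by simp) fun s hs => ?_
      have h1 : (s * δ) ^ a ≤ δ ^ a :=
        pow_le_pow_left₀ (mul_nonneg hs.1 hδ.le) (mul_le_of_le_one_left hδ.le hs.2) a
      have h2 : (s * Y) ^ b ≤ δ ^ a := by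
        rw [← hY]
        exact pow_le_pow_left₀ (mul_nonneg hs.1 hY0.le) (mul_le_of_le_one_left hY0.le hs.2) b
      have h3 : 0 ≤ (s * δ) ^ a := pow_nonneg (mul_nonneg hs.1 hδ.le) a
      have h4 : 0 ≤ (s * Y) ^ b := pow_nonneg (mul_nonneg hs.1 hY0.le) b
      refine mul_le_mul_of_nonneg_left (sq_le_sq' ?_ ?_) hY0.le <;> linarith
    simpa using this

theorem eventually_rpow_lt {q c : ℝ} (hq : 0 < q) (hc : 0 < c) :
    ∀ᶠ δ : ℝ in nhdsWithin 0 (Ioi 0), δ ^ q < c := by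
  have h : Filter.Tendsto (fun δ : ℝ => δ ^ q) (nhdsWithin 0 (Ioi 0)) (nhds 0) := by
    have := (Real.continuous_rpow_const hq.le).tendsto 0
    rw [Real.zero_rpow hq.ne'] at this
    exact this.mono_left nhdsWithin_le_nhds
  exact h.eventually_lt_const hc

/-- If `a > b ≥ 3` or `(a,b) = (3,2)`, then for every `ε > 0` the curve
`γ_ε(t) = (t, t^{a/b}, 0)` is not length-minimizing: there is a horizontal curve with the same
endpoints and strictly smaller length. -/
theorem gamma_not_minimizing' (a b : ℕ)
    (hab : (3 ≤ b ∧ b < a) ∨ (a = 3 ∧ b = 2)) (ε : ℝ) (hε : 0 < ε) :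
    ∃ τ : ℝ, 0 < τ ∧ ∃ η : HorizontalCurve a b τ,
      η.x 0 = 0 ∧ η.y 0 = 0 ∧ η.z 0 = 0 ∧
      η.x τ = ε ∧ η.y τ = ε ^ ((a : ℝ) / b) ∧ η.z τ = 0 ∧
      η.length < ∫ t in (0:ℝ)..ε,
        Real.sqrt (1 + ((a : ℝ) / b) ^ 2 * t ^ (2 * ((a : ℝ) / b) - 2)) := by
  have hb : 0 < b := by omega
  have hba : b < a := by omega
  have hb' : (0 : ℝ) < b := by exact_mod_cast hb
  have hr : 1 < (a : ℝ) / b := by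
    rw [one_lt_div hb']
    exact_mod_cast hba
  have hexp : 5 * ((a : ℝ) / b) < 2 * a + 3 := by
    rcases hab with ⟨h3, -⟩ | ⟨rfl, rfl⟩
    · have h3' : (3 : ℝ) ≤ b := by exact_mod_cast h3
      have : (a : ℝ) / b ≤ a / 3 := by gcongr
      have : (0 : ℝ) ≤ a := by positivity
      linarith
    · norm_num
  have hYb : (ε ^ ((a : ℝ) / b)) ^ b = ε ^ a := by
    rw [← Real.rpow_natCast (ε ^ _) b, ← Real.rpow_mul hε.le, div_mul_cancel₀ _ hb'.ne',
      Real.rpow_natCast]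
  have hY0 : 0 < ε ^ ((a : ℝ) / b) := by positivity
  have hchord := fun δ hδ => reach_chord (a := a) (b := b) (δ := δ) hb hδ
  have harc := fun δ (hδ : 0 < δ) (h : δ < ε) => reach_arc hb hba hδ h
  set r := (a : ℝ) / b with hrdef
  obtain ⟨p, hp1, hp2⟩ : ∃ p, 2 * r - 1 < p ∧ p < (2 * a + r) / 3 :=
    exists_between (by linarith)
  have hc : 0 < (r - 1) ^ 2 / (4 * (2 * r - 1)) :=
    div_pos (pow_pos (by linarith) 2) (by linarith)
  set c := (r - 1) ^ 2 / (4 * (2 * r - 1)) with hcdef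
  obtain ⟨δ, hδ0, hδε, hδY, hδK, hδc, hδr⟩ : ∃ δ : ℝ, 0 < δ ∧ δ < ε ∧ δ ^ p < ε ^ r ∧
      δ ^ (2 * a + r - 3 * p) < (ε ^ (a - 1)) ^ 2 ∧ δ ^ (p - (2 * r - 1)) < c / 4 ∧
      δ ^ (2 * r - 2) < 2 * (r - 1) ^ 2 / r ^ 2 / r ^ 2 := by
    have hlast : 0 < 2 * (r - 1) ^ 2 / r ^ 2 / r ^ 2 := by
      have : 0 < r - 1 := by linarith
      positivity
    have hev := (eventually_rpow_lt (q := p) (by linarith) hY0).and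
      ((eventually_rpow_lt (q := 2 * a + r - 3 * p) (c := (ε ^ (a - 1)) ^ 2) (by linarith)
        (by positivity)).and
      ((eventually_rpow_lt (q := p - (2 * r - 1)) (c := c / 4) (by linarith) (by linarith)).and
      (eventually_rpow_lt (q := 2 * r - 2) (by linarith) hlast)))
    obtain ⟨δ, ⟨h1, h2, h3, h4⟩, h5, h6⟩ := (hev.and (Ioo_mem_nhdsGT hε)).exists
    exact ⟨δ, h5, h6, h1, h2, h3, h4⟩
  obtain ⟨K, hK0, hKle, hreach⟩ := hchord δ hδ0
  have hu : 0 < δ ^ p := by positivity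
  have hKu : K ≤ (ε ^ (a - 1)) ^ 2 * (δ ^ p) ^ 3 := by
    have h3 : (δ ^ p) ^ 3 = δ ^ (3 * p) := by
      rw [← Real.rpow_natCast, ← Real.rpow_mul hδ0.le]
      congr 1
      push_cast
      ring
    calc K ≤ δ ^ (2 * (a : ℝ) + r) := hKle
      _ = δ ^ (2 * a + r - 3 * p) * (δ ^ p) ^ 3 := by
        rw [h3, ← Real.rpow_add hδ0, sub_add_cancel]
      _ ≤ _ := by gcongr
  obtain ⟨L, hL, hrect⟩ := reach_rectangle (by omega) hε hYb hu hδY.le hK0 hKu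
  obtain ⟨τ, hτ, η, hx0, hy0, hz0, hx1, hy1, hz1, hlen, -, -⟩ :=
    (hreach.trans (harc δ hδ0 hδε K)).trans hrect
  refine ⟨τ, hτ, η, hx0, hy0, hz0, hx1, hy1, hz1, ?_⟩
  have hsmall : r ^ 2 * δ ^ (2 * r - 2) ≤ 2 * (r - 1) ^ 2 / r ^ 2 := by
    rw [lt_div_iff₀ (by positivity)] at hδr
    linarith
  have hgain := chord_add_le_arc hr hδ0 hsmall
  have hcost : 4 * δ ^ p < c * δ ^ (2 * r - 1) := by
    have h1 : δ ^ p = δ ^ (p - (2 * r - 1)) * δ ^ (2 * r - 1) := by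
      rw [← Real.rpow_add hδ0, sub_add_cancel]
    have h2 : 0 < δ ^ (2 * r - 1) := by positivity
    rw [h1]
    nlinarith
  rw [hlen, ← intervalIntegral.integral_add_adjacent_intervals
    ((continuous_speed hr).intervalIntegrable 0 δ) ((continuous_speed hr).intervalIntegrable δ ε)]
  linarith
end

section
/- Let a = 2 and let b ≥ 5 be an odd natural number. Then there exists ε > 0 such that the curve γ_ε : [0,ε] → ℝ³, γ_ε(t) = (t^{b/2}, t, 0), is length-minimizing: for every τ > 0 and every horizontal curve η̃ : [0,τ] → ℝ³ with η̃(0) = (0,0,0) and η̃(τ) = (ε^{b/2}, ε, 0), one has L(γ_ε) ≤ L(η̃). -/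
open MeasureTheory Set

/-- `f` is absolutely continuous on `[0, τ]` with almost everywhere derivative `d`. -/
def HasACDeriv (f d : ℝ → ℝ) (τ : ℝ) : Prop :=
  AbsolutelyContinuousOnInterval f 0 τ ∧ ∀ᵐ t, t ∈ uIcc 0 τ → HasDerivAt f (d t) t

namespace HasACDeriv

variable {f g d e : ℝ → ℝ} {τ : ℝ}

theorem of_intervalIntegrable (hd : IntervalIntegrable d volume 0 τ) :
    HasACDeriv (fun t ↦ ∫ s in (0 : ℝ)..t, d s) d τ := by
  refine ⟨hd.absolutelyContinuousOnInterval_intervalIntegral left_mem_uIcc, ?_⟩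
  filter_upwards [hd.ae_hasDerivAt_integral] with t ht h
  exact ht h 0 left_mem_uIcc

theorem add (hf : HasACDeriv f d τ) (hg : HasACDeriv g e τ) :
    HasACDeriv (fun t ↦ f t + g t) (fun t ↦ d t + e t) τ := by
  refine ⟨hf.1.fun_add hg.1, ?_⟩
  filter_upwards [hf.2, hg.2] with t h1 h2 h
  exact (h1 h).fun_add (h2 h)

theorem mul (hf : HasACDeriv f d τ) (hg : HasACDeriv g e τ) :
    HasACDeriv (fun t ↦ f t * g t) (fun t ↦ d t * g t + f t * e t) τ := by
  refine ⟨hf.1.fun_mul hg.1, ?_⟩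
  filter_upwards [hf.2, hg.2] with t h1 h2 h
  exact (h1 h).fun_mul (h2 h)

theorem comp {F F' : ℝ → ℝ} (hF : ∀ y, HasDerivAt F (F' y) y) (hF' : Continuous F')
    (hf : HasACDeriv f d τ) :
    HasACDeriv (fun t ↦ F (f t)) (fun t ↦ F' (f t) * d t) τ := by
  refine ⟨?_, ?_⟩
  · obtain ⟨C, hC⟩ := hf.1.exists_bound
    obtain ⟨K, hK⟩ := (isCompact_Icc (a := -C) (b := C)).exists_bound_of_continuousOn
      hF'.continuousOn
    have hmem : ∀ t ∈ uIcc 0 τ, f t ∈ Icc (-C) C := fun t ht ↦ abs_le.mp (hC t ht)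
    have hlip : ∀ s ∈ uIcc 0 τ, ∀ t ∈ uIcc 0 τ, dist (F (f s)) (F (f t)) ≤ K * dist (f s) (f t) :=
      fun s hs t ht ↦ by
        rw [dist_eq_norm, dist_eq_norm]
        exact (convex_Icc (-C) C).norm_image_sub_le_of_norm_hasDerivWithin_le
          (fun y _ ↦ (hF y).hasDerivWithinAt) hK (hmem t ht) (hmem s hs)
    have hlim := Filter.Tendsto.const_mul K hf.1
    rw [mul_zero] at hlim
    refine squeeze_zero' (Filter.Eventually.of_forall fun E ↦
      Finset.sum_nonneg fun i _ ↦ dist_nonneg) ?_ hlim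
    refine Filter.eventually_inf_principal.2 (Filter.Eventually.of_forall fun E hE ↦ ?_)
    rw [Finset.mul_sum]
    exact Finset.sum_le_sum fun i hi ↦ hlip _ (hE.1 i hi).1 _ (hE.1 i hi).2
  · filter_upwards [hf.2] with t h1 h
    exact (hF (f t)).comp t (h1 h)

theorem mono (hf : HasACDeriv f d τ) {σ : ℝ} (hσ : σ ∈ uIcc 0 τ) : HasACDeriv f d σ := by
  have hsub : uIcc 0 σ ⊆ uIcc 0 τ := uIcc_subset_uIcc left_mem_uIcc hσ
  refine ⟨hf.1.mono hsub, ?_⟩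
  filter_upwards [hf.2] with t h1 h
  exact h1 (hsub h)

theorem deriv_ae_eq (hf : HasACDeriv f d τ) : ∀ᵐ t, t ∈ uIoc 0 τ → deriv f t = d t := by
  filter_upwards [hf.2] with t h1 h
  exact (h1 (uIoc_subset_uIcc h)).deriv

theorem intervalIntegrable (hf : HasACDeriv f d τ) : IntervalIntegrable d volume 0 τ :=
  hf.1.intervalIntegrable_deriv.congr_ae
    ((ae_restrict_iff' measurableSet_uIoc).2 hf.deriv_ae_eq)

theorem integral_eq (hf : HasACDeriv f d τ) : ∫ t in (0 : ℝ)..τ, d t = f τ - f 0 := by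
  rw [← hf.1.integral_deriv_eq_sub]
  exact (intervalIntegral.integral_congr_ae hf.deriv_ae_eq).symm

end HasACDeriv

/-- The function `y ^ (k + 1/2)`, extended by zero to negative `y`. -/
noncomputable def halfPow (k : ℕ) (y : ℝ) : ℝ := y ^ k * √y

theorem continuous_halfPow (k : ℕ) : Continuous (halfPow k) := by
  unfold halfPow; fun_prop

theorem halfPow_nonneg (k : ℕ) (y : ℝ) : 0 ≤ halfPow k y := by
  rcases le_total 0 y with h | h
  · exact mul_nonneg (pow_nonneg h k) (Real.sqrt_nonneg y)
  · simp [halfPow, Real.sqrt_eq_zero_of_nonpos h]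

theorem halfPow_of_nonpos (k : ℕ) {y : ℝ} (h : y ≤ 0) : halfPow k y = 0 := by
  simp [halfPow, Real.sqrt_eq_zero_of_nonpos h]

theorem halfPow_le_sqrt (k : ℕ) {y : ℝ} (h : y ≤ 1) : halfPow k y ≤ √y := by
  rcases le_total 0 y with h0 | h0
  · exact mul_le_of_le_one_left (Real.sqrt_nonneg y) (pow_le_one₀ h0 h)
  · rw [halfPow_of_nonpos k h0]; exact Real.sqrt_nonneg y

theorem hasDerivAt_halfPow (k : ℕ) (y : ℝ) :
    HasDerivAt (halfPow (k + 1)) ((k + 3 / 2) * halfPow k y) y := by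
  rcases lt_trichotomy y 0 with h | rfl | h
  · rw [halfPow_of_nonpos k h.le, mul_zero]
    refine (hasDerivAt_const y (0 : ℝ)).congr_of_eventuallyEq ?_
    filter_upwards [Iio_mem_nhds h] with z hz
    exact halfPow_of_nonpos _ (le_of_lt hz)
  · rw [halfPow_of_nonpos k le_rfl, mul_zero, hasDerivAt_iff_tendsto_slope]
    have hlim : Filter.Tendsto (halfPow k) (nhdsWithin 0 {0}ᶜ) (nhds 0) := by
      have := (continuous_halfPow k).tendsto 0
      rw [halfPow_of_nonpos k le_rfl] at this
      exact this.mono_left nhdsWithin_le_nhds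
    refine hlim.congr' ?_
    filter_upwards [self_mem_nhdsWithin] with z hz
    have hz' : z ≠ 0 := hz
    rw [slope_def_field, halfPow_of_nonpos (k + 1) le_rfl]
    simp only [halfPow]
    field_simp
    ring
  · have h1 := (hasDerivAt_pow (k + 1) y).mul (Real.hasDerivAt_sqrt h.ne')
    refine h1.congr_deriv ?_
    have hs : √y ≠ 0 := (Real.sqrt_pos.2 h).ne'
    have hy : y = √y ^ 2 := (Real.sq_sqrt h.le).symm
    simp only [halfPow, Nat.add_sub_cancel]
    generalize √y = s at hs hy
    subst hy
    push_cast
    field_simp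
    ring

/-- For a unit covector `(α, β)` close to `(0, 1)`, the calibration defect controls the speed. -/
theorem calibration_defect {α β q e u v : ℝ} (hαβ : α ^ 2 + β ^ 2 = 1) (hα0 : 0 ≤ α)
    (hα : α ≤ 1 / 10) (hβ : 0 ≤ β) (hq0 : 0 ≤ q) (hq : q ≤ 1) (he : e ≤ 1 / 5)
    (heq : 0 ≤ e + q / 2) :
    q * √(u ^ 2 + v ^ 2) / 4 ≤ √(u ^ 2 + v ^ 2) - α * u - β * v + (q + e) * v := by
  have hw0 : 0 ≤ √(u ^ 2 + v ^ 2) := Real.sqrt_nonneg _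
  have hw2 : √(u ^ 2 + v ^ 2) ^ 2 = u ^ 2 + v ^ 2 := Real.sq_sqrt (by positivity)
  set w := √(u ^ 2 + v ^ 2)
  have hu : |u| ≤ w := abs_le_of_sq_le_sq (by nlinarith [sq_nonneg v]) hw0
  have hv : |v| ≤ w := abs_le_of_sq_le_sq (by nlinarith [sq_nonneg u]) hw0
  obtain ⟨hu1, hu2⟩ := abs_le.1 hu
  obtain ⟨hv1, hv2⟩ := abs_le.1 hv
  have hβ1 : β ≤ 1 := by nlinarith
  have hβ9 : 9 / 10 ≤ β := by nlinarith
  have hau : α * u ≤ w / 10 := by nlinarith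
  have hqw : q * w ≤ w := mul_le_of_le_one_left hw0 hq
  rcases le_total 0 v with h | h
  · have hev : 0 ≤ (e + q / 2) * v := mul_nonneg heq h
    rcases le_total (w / 2) v with h2 | h2
    · have hcs : α * u + β * v ≤ w := by
        refine le_of_sq_le_sq ?_ hw0
        nlinarith [sq_nonneg (α * v - β * u)]
      nlinarith [mul_le_mul_of_nonneg_left h2 hq0]
    · nlinarith [mul_nonneg hq0 h, mul_le_mul_of_nonneg_right hβ1 h]
  · nlinarith [mul_nonneg (sub_nonneg.2 hβ9) (neg_nonneg.2 h),
      mul_nonneg (sub_nonneg.2 hq) (neg_nonneg.2 h),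
      mul_nonneg (sub_nonneg.2 he) (neg_nonneg.2 h)]

/-- The gain of length obtained by leaving the curve `x = φ(y)` at height `y > 0` is dominated by
the penalization of `P = u (u + 2φ)`, up to the error term `g`. -/
theorem curvature_gain_le {n : ℕ} {c m y u a : ℝ} (hc : 0 < c) (hm : 0 < m) (hy : 0 < y)
    (hy1 : y ≤ 1) (hu : u ≤ 1) (ha : 0 ≤ a) (hac : a ≤ c ^ 2 * halfPow n y) :
    a * u ≤ c ^ 2 * √y * (2 * c * m / (|y| + c * m))
      + (u * (u + 2 * halfPow (n + 2) y)) ^ 2 / m ^ 2 / 2 := by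
  have hφ := halfPow_nonneg (n + 2) y
  have hs := Real.sqrt_nonneg y
  have hcm : 0 < c * m := mul_pos hc hm
  rw [abs_of_pos hy]
  have hψ : a ≤ c ^ 2 * √y :=
    hac.trans (mul_le_mul_of_nonneg_left (halfPow_le_sqrt n hy1) (sq_nonneg c))
  set A := 2 * c * m / (y + c * m) with hA
  have hA0 : 0 < A := by positivity
  have hsq : 0 ≤ (u * (u + 2 * halfPow (n + 2) y)) ^ 2 / m ^ 2 / 2 := by positivity
  have hgA : 0 ≤ c ^ 2 * √y * A := by positivity
  rcases le_total u A with h | h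
  · have h1 : a * u ≤ c ^ 2 * √y * A :=
      (mul_le_mul_of_nonneg_left h ha).trans (mul_le_mul_of_nonneg_right hψ hA0.le)
    nlinarith
  · have hu0 : 0 < u := hA0.trans_le h
    have hA1 : A ≤ 1 := h.trans hu
    have hcy : c * m ≤ y := by
      rw [hA, div_le_one (by positivity)] at hA1
      linarith
    have hAy : c * m ≤ A * y := by
      rw [hA, div_mul_eq_mul_div, le_div_iff₀ (by positivity)]
      nlinarith
    have huy : c * m ≤ u * y := hAy.trans (mul_le_mul_of_nonneg_right h hy.le)
    have huy2 : c ^ 2 * m ^ 2 ≤ u ^ 2 * y ^ 2 := by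
      rw [← mul_pow, ← mul_pow]
      exact pow_le_pow_left₀ hcm.le huy 2
    have hpow : halfPow (n + 2) y = y ^ 2 * halfPow n y := by simp only [halfPow]; ring
    have hn := halfPow_nonneg n y
    have key : a * u ≤ (u * (u + 2 * halfPow (n + 2) y)) ^ 2 / m ^ 2 / 2 := by
      rw [div_div, le_div_iff₀ (by positivity)]
      rw [hpow]
      have h1 : 8 * u ^ 3 * (y ^ 2 * halfPow n y) ≤ (u * (u + 2 * (y ^ 2 * halfPow n y))) ^ 2 := by
        have : (u * (u + 2 * (y ^ 2 * halfPow n y))) ^ 2 - 8 * u ^ 3 * (y ^ 2 * halfPow n y)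
          = u ^ 2 * (u - 2 * (y ^ 2 * halfPow n y)) ^ 2 := by ring
        have : 0 ≤ u ^ 2 * (u - 2 * (y ^ 2 * halfPow n y)) ^ 2 := by positivity
        linarith
      refine le_trans ?_ h1
      calc a * u * (m ^ 2 * 2) ≤ c ^ 2 * halfPow n y * u * (m ^ 2 * 2) := by gcongr
        _ = c ^ 2 * m ^ 2 * (2 * u * halfPow n y) := by ring
        _ ≤ u ^ 2 * y ^ 2 * (2 * u * halfPow n y) := by gcongr
        _ ≤ 8 * u ^ 3 * (y ^ 2 * halfPow n y) := by
          have : 0 ≤ u ^ 3 * (y ^ 2 * halfPow n y) := by positivity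
          nlinarith
    nlinarith

theorem continuous_const_div_sqrt_one_add_sq {f : ℝ → ℝ} (hf : Continuous f) :
    Continuous fun y ↦ 1 / √(1 + f y ^ 2) := by
  refine continuous_const.div (by fun_prop) fun y ↦ ?_
  positivity

/-- Derivative of the sine of the angle whose tangent is `f`. -/
theorem hasDerivAt_div_sqrt_one_add_sq {f : ℝ → ℝ} {slope y : ℝ} (hf : HasDerivAt f slope y) :
    HasDerivAt (fun y ↦ f y / √(1 + f y ^ 2)) (slope / √(1 + f y ^ 2) ^ 3) y := by
  have hpos : 0 < 1 + f y ^ 2 := by positivity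
  have hR : √(1 + f y ^ 2) ^ 2 = 1 + f y ^ 2 := Real.sq_sqrt hpos.le
  have hR0 : √(1 + f y ^ 2) ≠ 0 := (Real.sqrt_pos.2 hpos).ne'
  have h1 : HasDerivAt (fun y ↦ √(1 + f y ^ 2)) _ y := ((hf.fun_pow 2).const_add 1).sqrt hpos.ne'
  refine (hf.fun_div h1 hR0).congr_deriv ?_
  generalize √(1 + f y ^ 2) = r at hR hR0
  have hr : f y ^ 2 = r ^ 2 - 1 := by linarith
  field_simp
  simp only [Nat.cast_ofNat, Nat.add_one_sub_one, pow_one]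
  linear_combination (-2 * slope) * hr

/-- The slope `φ'` of the curve `x = φ(y) = y ^ (n + 5/2)`. -/
noncomputable def curveSlope (n : ℕ) (y : ℝ) : ℝ := (n + 5 / 2) * halfPow (n + 1) y

/-- The second derivative of `φ(y) = y ^ (n + 5/2)`. -/
noncomputable def curveSlopeDeriv (n : ℕ) (y : ℝ) : ℝ :=
  (n + 5 / 2) * ((n + 3 / 2) * halfPow n y)

theorem hasDerivAt_halfPow_curveSlope (n : ℕ) (y : ℝ) :
    HasDerivAt (halfPow (n + 2)) (curveSlope n y) y := by
  refine (hasDerivAt_halfPow (n + 1) y).congr_deriv ?_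
  rw [curveSlope]; push_cast; ring

theorem hasDerivAt_curveSlope (n : ℕ) (y : ℝ) :
    HasDerivAt (curveSlope n) (curveSlopeDeriv n y) y :=
  (hasDerivAt_halfPow n y).const_mul _

theorem continuous_curveSlope (n : ℕ) : Continuous (curveSlope n) :=
  continuous_const.mul (continuous_halfPow _)

theorem continuous_curveSlopeDeriv (n : ℕ) : Continuous (curveSlopeDeriv n) :=
  continuous_const.mul (continuous_const.mul (continuous_halfPow _))

theorem curveSlope_nonneg (n : ℕ) (y : ℝ) : 0 ≤ curveSlope n y :=
  mul_nonneg (by positivity) (halfPow_nonneg _ _)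

theorem curveSlopeDeriv_nonneg (n : ℕ) (y : ℝ) : 0 ≤ curveSlopeDeriv n y :=
  mul_nonneg (by positivity) (mul_nonneg (by positivity) (halfPow_nonneg _ _))

theorem curveSlopeDeriv_le (n : ℕ) (y : ℝ) :
    curveSlopeDeriv n y ≤ (n + 5 / 2 : ℝ) ^ 2 * halfPow n y := by
  have := halfPow_nonneg n y
  have hn : (0 : ℝ) ≤ n := n.cast_nonneg
  rw [curveSlopeDeriv]
  nlinarith [mul_nonneg hn this]

/-- The horizontal component of the calibrating covector field. -/
noncomputable def calibSin (n : ℕ) (y : ℝ) : ℝ := curveSlope n y / √(1 + curveSlope n y ^ 2)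

/-- The vertical component of the calibrating covector field. -/
noncomputable def calibCos (n : ℕ) (y : ℝ) : ℝ := 1 / √(1 + curveSlope n y ^ 2)

/-- The derivative of `calibSin`. -/
noncomputable def calibSinDeriv (n : ℕ) (y : ℝ) : ℝ :=
  curveSlopeDeriv n y / √(1 + curveSlope n y ^ 2) ^ 3

theorem hasDerivAt_calibSin (n : ℕ) (y : ℝ) : HasDerivAt (calibSin n) (calibSinDeriv n y) y :=
  hasDerivAt_div_sqrt_one_add_sq (hasDerivAt_curveSlope n y)

theorem continuous_calibSinDeriv (n : ℕ) : Continuous (calibSinDeriv n) := by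
  refine (continuous_curveSlopeDeriv n).div ?_ fun y ↦ by positivity
  have := continuous_curveSlope n
  fun_prop

theorem continuous_calibCos (n : ℕ) : Continuous (calibCos n) :=
  continuous_const_div_sqrt_one_add_sq (continuous_curveSlope n)

theorem continuous_calibSin (n : ℕ) : Continuous (calibSin n) :=
  continuous_iff_continuousAt.2 fun y ↦ (hasDerivAt_calibSin n y).continuousAt

theorem one_le_sqrt_one_add_sq (z : ℝ) : 1 ≤ √(1 + z ^ 2) :=
  Real.one_le_sqrt.2 (by nlinarith [sq_nonneg z])

theorem calibSin_sq_add_calibCos_sq (n : ℕ) (y : ℝ) : calibSin n y ^ 2 + calibCos n y ^ 2 = 1 := by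
  have h : √(1 + curveSlope n y ^ 2) ^ 2 = 1 + curveSlope n y ^ 2 := Real.sq_sqrt (by positivity)
  rw [calibSin, calibCos, div_pow, div_pow, h]
  field_simp
  ring

theorem calibSin_nonneg (n : ℕ) (y : ℝ) : 0 ≤ calibSin n y :=
  div_nonneg (curveSlope_nonneg n y) (Real.sqrt_nonneg _)

theorem calibCos_nonneg (n : ℕ) (y : ℝ) : 0 ≤ calibCos n y := by unfold calibCos; positivity

theorem calibSinDeriv_nonneg (n : ℕ) (y : ℝ) : 0 ≤ calibSinDeriv n y :=
  div_nonneg (curveSlopeDeriv_nonneg n y) (by positivity)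

theorem calibSin_le (n : ℕ) (y : ℝ) : calibSin n y ≤ curveSlope n y :=
  div_le_self (curveSlope_nonneg n y) (one_le_sqrt_one_add_sq _)

theorem calibSinDeriv_le (n : ℕ) (y : ℝ) : calibSinDeriv n y ≤ curveSlopeDeriv n y :=
  div_le_self (curveSlopeDeriv_nonneg n y) (one_le_pow₀ (one_le_sqrt_one_add_sq _))

/-- An upper bound, integrable in `y`, for the gain of length per unit of height. -/
noncomputable def gainRate (c m y : ℝ) : ℝ := c ^ 2 * √y * (2 * c * m / (|y| + c * m))

theorem continuous_gainRate {c m : ℝ} (h : 0 < c * m) : Continuous (gainRate c m) := by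
  unfold gainRate
  refine (by fun_prop : Continuous fun y ↦ c ^ 2 * √y).mul
    (continuous_const.div (by fun_prop) fun y ↦ ?_)
  positivity

theorem gainRate_le {c m : ℝ} (h : 0 < c * m) (y : ℝ) : gainRate c m y ≤ 2 * c ^ 2 * √y := by
  have h1 : 2 * c * m / (|y| + c * m) ≤ 2 := by
    rw [div_le_iff₀ (by positivity)]
    nlinarith [abs_nonneg y]
  unfold gainRate
  nlinarith [mul_le_mul_of_nonneg_left h1 (by positivity : 0 ≤ c ^ 2 * √y)]

theorem integral_gainRate_le {c m ε : ℝ} (hc : 0 < c) (hm : 0 < m) (hε : 0 ≤ ε) :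
    ∫ y in (0 : ℝ)..ε, gainRate c m y ≤ 4 * c ^ 3 * m * √ε := by
  have hcm := mul_pos hc hm
  have hcont := continuous_gainRate hcm
  have hder (y : ℝ) : HasDerivAt (fun y ↦ ∫ s in (0 : ℝ)..y, gainRate c m s) (gainRate c m y) y :=
    (hcont.integral_hasStrictDerivAt 0 y).hasDerivAt
  have hder2 : ∀ y ∈ interior (Icc 0 ε),
      HasDerivAt (fun y ↦ 4 * c ^ 3 * m * √y - ∫ s in (0 : ℝ)..y, gainRate c m s)
        (4 * c ^ 3 * m * (1 / (2 * √y)) - gainRate c m y) y := fun y hy ↦ by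
    rw [interior_Icc] at hy
    exact ((Real.hasDerivAt_sqrt hy.1.ne').const_mul _).sub (hder y)
  have hmono : MonotoneOn (fun y ↦ 4 * c ^ 3 * m * √y - ∫ s in (0 : ℝ)..y, gainRate c m s)
      (Icc 0 ε) := by
    refine monotoneOn_of_hasDerivWithinAt_nonneg (convex_Icc 0 ε) ?_
      (fun y hy ↦ (hder2 y hy).hasDerivWithinAt) fun y hy ↦ ?_
    · have : Continuous fun y ↦ ∫ s in (0 : ℝ)..y, gainRate c m s :=
        continuous_iff_continuousAt.2 fun y ↦ (hder y).continuousAt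
      exact (by fun_prop : Continuous fun y ↦
        4 * c ^ 3 * m * √y - ∫ s in (0 : ℝ)..y, gainRate c m s).continuousOn
    · rw [interior_Icc] at hy
      have hs : 0 < √y := Real.sqrt_pos.2 hy.1
      have hs2 : y = √y ^ 2 := (Real.sq_sqrt hy.1.le).symm
      rw [sub_nonneg, gainRate, abs_of_pos hy.1, ← mul_div_assoc, ← mul_div_assoc,
        div_le_div_iff₀ (by have := hy.1; positivity) (by positivity)]
      generalize √y = s at hs hs2
      subst hs2
      have : 0 ≤ c ^ 3 * m * (c * m) := by positivity
      nlinarith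
  have h := hmono (left_mem_Icc.2 hε) (right_mem_Icc.2 hε) hε
  simp only [Real.sqrt_zero, mul_zero, intervalIntegral.integral_same, sub_zero] at h
  linarith

/-- The calibration identity: the covector field `calibSin dx + calibCos dy` integrates along
`x = φ(y)` to the length of that curve. -/
theorem calibSin_mul_add_integral (n : ℕ) (ε : ℝ) :
    calibSin n ε * halfPow (n + 2) ε +
      ∫ y in (0 : ℝ)..ε, (calibCos n y - calibSinDeriv n y * halfPow (n + 2) y) =
    ∫ y in (0 : ℝ)..ε, √(1 + curveSlope n y ^ 2) := by
  have c1 := continuous_calibSinDeriv n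
  have c2 := continuous_calibCos n
  have c3 := continuous_halfPow (n + 2)
  have c4 := continuous_curveSlope n
  have c5 := continuous_calibSin n
  have hF := intervalIntegral.integral_eq_sub_of_hasDerivAt (a := 0) (b := ε)
    (fun y _ ↦ (hasDerivAt_calibSin n y).fun_mul (hasDerivAt_halfPow_curveSlope n y))
    (Continuous.intervalIntegrable (by fun_prop) _ _)
  rw [halfPow_of_nonpos (n + 2) le_rfl, mul_zero, sub_zero] at hF
  rw [← hF, ← intervalIntegral.integral_add (Continuous.intervalIntegrable (by fun_prop) _ _)
    (Continuous.intervalIntegrable (by fun_prop) _ _)]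
  refine intervalIntegral.integral_congr fun y _ ↦ ?_
  have h : √(1 + curveSlope n y ^ 2) ^ 2 = 1 + curveSlope n y ^ 2 := Real.sq_sqrt (by positivity)
  have h0 : √(1 + curveSlope n y ^ 2) ≠ 0 := by positivity
  simp only [calibSin, calibCos]
  generalize √(1 + curveSlope n y ^ 2) = r at h h0
  field_simp
  linear_combination -h

/-- Inside the small box of radius `2δ²`, the penalized calibration defect controls the speed. -/
theorem penalized_defect {n : ℕ} {δ m x y u v : ℝ} (hδ : 0 < δ)
    (hδ' : 100 * (n + 5 / 2 : ℝ) ^ 3 * δ ≤ 1) (hm : 0 < m) (hx : |x| ≤ 2 * δ ^ 2)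
    (hy : |y| ≤ 2 * δ ^ 2) (hP : |x ^ 2 - y ^ (2 * n + 5)| ≤ m) :
    (x ^ 2 - y ^ (2 * n + 5)) ^ 2 / m ^ 2 * √(u ^ 2 + v ^ 2) / 4 ≤
      √(u ^ 2 + v ^ 2) - calibSin n y * u - calibCos n y * v +
        ((x ^ 2 - y ^ (2 * n + 5)) ^ 2 / m ^ 2 + (gainRate (n + 5 / 2) m y -
          calibSinDeriv n y * (x - halfPow (n + 2) y))) * v := by
  have hn : (0 : ℝ) ≤ n := n.cast_nonneg
  set c : ℝ := n + 5 / 2 with hc_def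
  have hc : 5 / 2 ≤ c := by linarith
  have hc0 : 0 < c := by linarith
  have hcm : 0 < c * m := mul_pos hc0 hm
  have hc2 : c ≤ c ^ 2 := by nlinarith
  have hc3 : c ^ 2 ≤ c ^ 3 := by nlinarith [sq_nonneg c]
  have hcδ : 100 * (c ^ 2 * δ) ≤ 1 := by nlinarith
  have hcδ1 : 100 * (c * δ) ≤ 1 := by nlinarith
  have hδ1 : 100 * δ ≤ 1 := by nlinarith
  have hδ2 : 2 * δ ^ 2 ≤ δ := by nlinarith
  have hy1 : y ≤ 1 := by linarith [le_abs_self y]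
  have hsqrt : √y ≤ 2 * δ := Real.sqrt_le_iff.2 ⟨by positivity, by nlinarith [le_abs_self y]⟩
  have hφ0 := halfPow_nonneg (n + 2) y
  have hφ : halfPow (n + 2) y ≤ 2 * δ := (halfPow_le_sqrt _ hy1).trans hsqrt
  obtain ⟨hx1, hx2⟩ := abs_le.1 hx
  have hα : calibSin n y ≤ 1 / 10 := by
    refine (calibSin_le n y).trans ?_
    have : curveSlope n y ≤ c * (2 * δ) :=
      mul_le_mul_of_nonneg_left ((halfPow_le_sqrt _ hy1).trans hsqrt) hc0.le
    linarith
  have hdα : calibSinDeriv n y ≤ c ^ 2 * halfPow n y :=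
    (calibSinDeriv_le n y).trans (curveSlopeDeriv_le n y)
  have hdα_nonneg := calibSinDeriv_nonneg n y
  have hdα_le : calibSinDeriv n y ≤ 1 / 10 := by
    have : c ^ 2 * halfPow n y ≤ c ^ 2 * (2 * δ) :=
      mul_le_mul_of_nonneg_left ((halfPow_le_sqrt _ hy1).trans hsqrt) (sq_nonneg c)
    linarith
  have hg : gainRate c m y ≤ 1 / 10 := by
    have : 2 * c ^ 2 * √y ≤ 2 * c ^ 2 * (2 * δ) := mul_le_mul_of_nonneg_left hsqrt (by positivity)
    linarith [gainRate_le hcm y]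
  refine calibration_defect (calibSin_sq_add_calibCos_sq n y) (calibSin_nonneg n y) hα
    (calibCos_nonneg n y) (by positivity) ?_ ?_ ?_
  · rw [div_le_one (by positivity)]
    exact sq_le_sq' (abs_le.1 hP).1 (abs_le.1 hP).2
  · nlinarith
  · rcases le_or_gt y 0 with h | h
    · have h0 : calibSinDeriv n y = 0 := by
        simp [calibSinDeriv, curveSlopeDeriv, halfPow_of_nonpos n h]
      have hg0 : gainRate c m y = 0 := by
        simp [gainRate, Real.sqrt_eq_zero_of_nonpos h]
      rw [h0, hg0, zero_mul, sub_zero, zero_add]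
      positivity
    · have hgain := curvature_gain_le (n := n) hc0 hm h hy1 (u := x - halfPow (n + 2) y)
        (by linarith) hdα_nonneg hdα
      have hsq : halfPow (n + 2) y ^ 2 = y ^ (2 * n + 5) := by
        rw [halfPow, mul_pow, Real.sq_sqrt h.le]; ring
      have hfac : (x - halfPow (n + 2) y) * (x - halfPow (n + 2) y + 2 * halfPow (n + 2) y)
          = x ^ 2 - y ^ (2 * n + 5) := by rw [← hsq]; ring
      rw [hfac] at hgain
      rw [gainRate]
      linarith

/-- Lower bound for the weighted length of an absolutely continuous function reaching `f σ`. -/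
theorem HasACDeriv.abs_pow_three_le_integral {f d w : ℝ → ℝ} {σ τ : ℝ} (hf : HasACDeriv f d τ)
    (hf0 : f 0 = 0) (hσ : σ ∈ Icc 0 τ) (hw : IntervalIntegrable w volume 0 τ)
    (hdw : ∀ t ∈ Icc 0 τ, |d t| ≤ w t) :
    |f σ| ^ 3 / 3 ≤ ∫ t in (0 : ℝ)..τ, f t ^ 2 * w t := by
  have hτ : 0 ≤ τ := hσ.1.trans hσ.2
  have hσ' : σ ∈ uIcc 0 τ := Icc_subset_uIcc hσ
  have hcube := (hf.comp (F := fun p ↦ p ^ 3 / 3) (F' := fun p ↦ p ^ 2)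
    (fun p ↦ ((hasDerivAt_pow 3 p).div_const 3).congr_deriv (by push_cast; ring))
    (by fun_prop)).mono hσ'
  have hfw : IntervalIntegrable (fun t ↦ f t ^ 2 * w t) volume 0 τ :=
    hw.continuousOn_mul (hf.1.continuousOn.pow 2)
  have h1 : |f σ| ^ 3 / 3 = |f σ ^ 3 / 3 - f 0 ^ 3 / 3| := by
    rw [hf0, abs_of_pos (by norm_num : (0 : ℝ) < 3) |>.symm]
    simp [abs_div]
  rw [h1, ← hcube.integral_eq]
  calc |∫ t in (0 : ℝ)..σ, f t ^ 2 * d t| ≤ ∫ t in (0 : ℝ)..σ, |f t ^ 2 * d t| :=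
        intervalIntegral.abs_integral_le_integral_abs hσ.1
    _ ≤ ∫ t in (0 : ℝ)..σ, f t ^ 2 * w t := by
        refine intervalIntegral.integral_mono_on hσ.1 hcube.intervalIntegrable.abs
          (hfw.mono_set (uIcc_subset_uIcc left_mem_uIcc hσ')) fun t ht ↦ ?_
        rw [abs_mul, abs_sq]
        exact mul_le_mul_of_nonneg_left (hdw t ⟨ht.1, ht.2.trans hσ.2⟩) (sq_nonneg _)
    _ ≤ ∫ t in (0 : ℝ)..τ, f t ^ 2 * w t := by
        refine intervalIntegral.integral_mono_interval le_rfl hσ.1 hσ.2 ?_ hfw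
        refine (ae_restrict_iff' measurableSet_Ioc).2 (Filter.Eventually.of_forall fun t ht ↦ ?_)
        exact mul_nonneg (sq_nonneg _) ((abs_nonneg _).trans (hdw t ⟨ht.1.le, ht.2⟩))

/-- The function `x² - y ^ b` is `1`-Lipschitz near the origin. -/
theorem abs_deriv_le_speed {b : ℕ} {x y u v : ℝ} (hx : |x| ≤ 1 / 4)
    (hy : b * |y| ≤ 1 / 2) (hy1 : |y| ≤ 1) (hb : 2 ≤ b := by omega) :
    |((2 : ℕ) : ℝ) * x ^ (2 - 1) * u + -((b : ℝ) * y ^ (b - 1)) * v| ≤ √(u ^ 2 + v ^ 2) := by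
  have hu : |u| ≤ √(u ^ 2 + v ^ 2) := Real.abs_le_sqrt (by nlinarith [sq_nonneg v])
  have hv : |v| ≤ √(u ^ 2 + v ^ 2) := Real.abs_le_sqrt (by nlinarith [sq_nonneg u])
  have hpow : |y| ^ (b - 1) ≤ |y| := pow_le_of_le_one (abs_nonneg _) hy1 (by omega)
  have h1 : |((2 : ℕ) : ℝ) * x ^ (2 - 1)| ≤ 1 / 2 := by
    simp only [Nat.cast_ofNat, Nat.add_one_sub_one, pow_one, abs_mul, abs_two]; linarith
  have h2 : |-((b : ℝ) * y ^ (b - 1))| ≤ 1 / 2 := by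
    rw [abs_neg, abs_mul, abs_pow, Nat.abs_cast]
    exact (mul_le_mul_of_nonneg_left hpow b.cast_nonneg).trans hy
  refine (abs_add_le _ _).trans ?_
  rw [abs_mul, abs_mul _ v]
  have h3 := mul_le_mul h1 hu (abs_nonneg _) (by norm_num)
  have h4 := mul_le_mul h2 hv (abs_nonneg _) (by norm_num)
  exact (add_le_add h3 h4).trans (by linarith)

/-- Lower bound for the length of a planar curve in a small box with the endpoints of `x = φ(y)`
along which `P² dy` integrates to zero. -/
theorem length_lower_bound {n : ℕ} {δ m τ σ : ℝ} {x y d1 d2 : ℝ → ℝ} (hδ : 0 < δ)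
    (hδ' : 100 * (n + 5 / 2 : ℝ) ^ 3 * δ ≤ 1) (hm : 0 < m) (hτ : 0 ≤ τ)
    (hx : HasACDeriv x d1 τ) (hy : HasACDeriv y d2 τ) (hx0 : x 0 = 0) (hy0 : y 0 = 0)
    (hxτ : x τ = halfPow (n + 2) (δ ^ 2)) (hyτ : y τ = δ ^ 2)
    (hxb : ∀ t ∈ Icc 0 τ, |x t| ≤ 2 * δ ^ 2) (hyb : ∀ t ∈ Icc 0 τ, |y t| ≤ 2 * δ ^ 2)
    (hP : ∀ t ∈ Icc 0 τ, |x t ^ 2 - y t ^ (2 * n + 5)| ≤ m)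
    (hz : ∫ t in (0 : ℝ)..τ, d2 t * (x t ^ 2 - y t ^ (2 * n + 5)) ^ 2 = 0) (hσ : σ ∈ Icc 0 τ)
    (hw : IntervalIntegrable (fun t ↦ √(d1 t ^ 2 + d2 t ^ 2)) volume 0 τ) :
    |x σ ^ 2 - y σ ^ (2 * n + 5)| ^ 3 / (12 * m ^ 2) - 4 * (n + 5 / 2 : ℝ) ^ 3 * m * δ ≤
      (∫ t in (0 : ℝ)..τ, √(d1 t ^ 2 + d2 t ^ 2)) -
        ∫ s in (0 : ℝ)..(δ ^ 2), √(1 + curveSlope n s ^ 2) := by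
  have hn : (0 : ℝ) ≤ n := n.cast_nonneg
  set c : ℝ := n + 5 / 2 with hc_def
  have hc : 5 / 2 ≤ c := by linarith
  have hc0 : 0 < c := by linarith
  have hcm : 0 < c * m := mul_pos hc0 hm
  have hc1 : c ≤ c ^ 3 := by nlinarith [sq_nonneg c, mul_pos hc0 hc0]
  have hcδ1 : 100 * (c * δ) ≤ 1 := by nlinarith
  have hδ1 : 100 * δ ≤ 1 := by nlinarith
  have hδ2 : 2 * δ ^ 2 ≤ δ := by nlinarith
  have hxc : ContinuousOn x (uIcc 0 τ) := hx.1.continuousOn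
  have hyc : ContinuousOn y (uIcc 0 τ) := hy.1.continuousOn
  set q : ℝ → ℝ := fun t ↦ (x t ^ 2 - y t ^ (2 * n + 5)) ^ 2 / m ^ 2 with hq_def
  have hqc : ContinuousOn q (uIcc 0 τ) := by fun_prop
  have hq0 : ∀ t, 0 ≤ q t := fun t ↦ by simp only [hq_def]; positivity
  set w : ℝ → ℝ := fun t ↦ √(d1 t ^ 2 + d2 t ^ 2) with hw_def
  have hw0 : ∀ t, 0 ≤ w t := fun t ↦ Real.sqrt_nonneg _
  have hqw : IntervalIntegrable (fun t ↦ q t * w t) volume 0 τ := hw.continuousOn_mul hqc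
  have hqd : IntervalIntegrable (fun t ↦ q t * d2 t) volume 0 τ :=
    hy.intervalIntegrable.continuousOn_mul hqc
  -- the calibration
  have c1 := continuous_calibSinDeriv n
  have c2 := continuous_calibCos n
  have c3 := continuous_halfPow (n + 2)
  have c4 := continuous_gainRate hcm
  have hKc : Continuous fun s ↦
      calibCos n s - calibSinDeriv n s * halfPow (n + 2) s - gainRate c m s := by fun_prop
  set K : ℝ → ℝ := fun r ↦ ∫ s in (0 : ℝ)..r,
    (calibCos n s - calibSinDeriv n s * halfPow (n + 2) s - gainRate c m s) with hK_def
  have hK : ∀ r, HasDerivAt K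
      (calibCos n r - calibSinDeriv n r * halfPow (n + 2) r - gainRate c m r) r := fun r ↦
    (hKc.integral_hasStrictDerivAt 0 r).hasDerivAt
  have hS := ((hy.comp (hasDerivAt_calibSin n) c1).mul hx).add (hy.comp hK hKc)
  have hSint := hS.integral_eq
  rw [hx0, hy0, hxτ, hyτ] at hSint
  have hKτ : calibSin n (δ ^ 2) * halfPow (n + 2) (δ ^ 2) + K (δ ^ 2) =
      (∫ s in (0 : ℝ)..(δ ^ 2), √(1 + curveSlope n s ^ 2)) -
        ∫ s in (0 : ℝ)..(δ ^ 2), gainRate c m s := by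
    rw [hK_def, ← calibSin_mul_add_integral]
    simp only
    rw [intervalIntegral.integral_sub (Continuous.intervalIntegrable (by fun_prop) _ _)
      (Continuous.intervalIntegrable (by fun_prop) _ _)]
    ring
  have hK0 : K 0 = 0 := intervalIntegral.integral_same
  have hgain := integral_gainRate_le hc0 hm (sq_nonneg δ)
  rw [Real.sqrt_sq hδ.le] at hgain
  have hzq : ∫ t in (0 : ℝ)..τ, q t * d2 t = 0 := by
    have : (fun t ↦ q t * d2 t) =
        fun t ↦ (d2 t * (x t ^ 2 - y t ^ (2 * n + 5)) ^ 2) * (1 / m ^ 2) := by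
      funext t; simp only [hq_def]; ring
    rw [this, intervalIntegral.integral_mul_const, hz, zero_mul]
  have hmain : (1 / 4) * ∫ t in (0 : ℝ)..τ, q t * w t ≤
      ((∫ t in (0 : ℝ)..τ, w t) + ∫ t in (0 : ℝ)..τ, q t * d2 t) -
        ∫ t in (0 : ℝ)..τ, (calibSinDeriv n (y t) * d2 t * x t + calibSin n (y t) * d1 t +
          (calibCos n (y t) - calibSinDeriv n (y t) * halfPow (n + 2) (y t) -
            gainRate c m (y t)) * d2 t) := by
    rw [← intervalIntegral.integral_const_mul, ← intervalIntegral.integral_add hw hqd,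
      ← intervalIntegral.integral_sub (hw.add hqd) hS.intervalIntegrable]
    refine intervalIntegral.integral_mono_on hτ (hqw.const_mul _)
      ((hw.add hqd).sub hS.intervalIntegrable) fun t ht ↦ ?_
    have := penalized_defect (u := d1 t) (v := d2 t) hδ hδ' hm (hxb t ht) (hyb t ht) (hP t ht)
    simp only [hq_def, hw_def]
    linarith
  have hPac := (hx.comp (fun r ↦ hasDerivAt_pow 2 r) (by fun_prop)).add
    (hy.comp (fun r ↦ (hasDerivAt_pow (2 * n + 5) r).fun_neg) (by fun_prop))
  have hosc : |x σ ^ 2 - y σ ^ (2 * n + 5)| ^ 3 / (3 * m ^ 2) ≤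
      ∫ t in (0 : ℝ)..τ, q t * w t := by
    have h := hPac.abs_pow_three_le_integral (by simp [hx0, hy0]) hσ hw fun t ht ↦
      abs_deriv_le_speed (by linarith [hxb t ht])
        (by push_cast; nlinarith [hyb t ht, abs_nonneg (y t)]) (by linarith [hyb t ht])
    have hq : (fun t ↦ q t * w t) = fun t ↦
        (x t ^ 2 + -y t ^ (2 * n + 5)) ^ 2 * √(d1 t ^ 2 + d2 t ^ 2) * (1 / m ^ 2) := by
      funext t; simp only [hq_def, hw_def]; ring
    rw [hq, intervalIntegral.integral_mul_const, mul_one_div, ← div_div]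
    rw [sub_eq_add_neg]
    exact div_le_div_of_nonneg_right h (sq_nonneg m)
  have hdiv : |x σ ^ 2 - y σ ^ (2 * n + 5)| ^ 3 / (12 * m ^ 2) =
      1 / 4 * (|x σ ^ 2 - y σ ^ (2 * n + 5)| ^ 3 / (3 * m ^ 2)) := by
    ring
  rw [hSint, hzq, hK0] at hmain
  rw [hdiv]
  linarith

theorem rpow_half_eq_halfPow {n : ℕ} {s : ℝ} (hs : 0 < s) :
    s ^ (((2 * n + 5 : ℕ) : ℝ) / 2) = halfPow (n + 2) s := by
  rw [halfPow, Real.sqrt_eq_rpow, ← Real.rpow_natCast, ← Real.rpow_add hs]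
  congr 1
  push_cast
  ring

theorem curveSlope_sq_eq {n : ℕ} {s : ℝ} (hs : 0 ≤ s) :
    curveSlope n s ^ 2 =
      (((2 * n + 5 : ℕ) : ℝ) / 2) ^ 2 * s ^ (2 * (((2 * n + 5 : ℕ) : ℝ) / 2) - 2) := by
  have h : 2 * (((2 * n + 5 : ℕ) : ℝ) / 2) - 2 = ((2 * n + 3 : ℕ) : ℝ) := by push_cast; ring
  rw [h, Real.rpow_natCast, curveSlope, halfPow, mul_pow, mul_pow, Real.sq_sqrt hs]
  push_cast
  ring

theorem integral_sqrt_one_add_curveSlope_sq_le {n : ℕ} {δ : ℝ} (hδ : 0 < δ) (hδ1 : δ ≤ 1)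
    (hcδ : (n + 5 / 2 : ℝ) * δ ≤ 1) :
    ∫ s in (0 : ℝ)..(δ ^ 2), √(1 + curveSlope n s ^ 2) ≤ 2 * δ ^ 2 := by
  have hc := continuous_curveSlope n
  have h : ∫ s in (0 : ℝ)..(δ ^ 2), √(1 + curveSlope n s ^ 2) ≤ ∫ _ in (0 : ℝ)..(δ ^ 2), (2 : ℝ) := by
    refine intervalIntegral.integral_mono_on (sq_nonneg δ)
      (Continuous.intervalIntegrable (by fun_prop) _ _) (by simp) fun s hs ↦ ?_
    have h1 : halfPow (n + 1) s ≤ δ :=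
      (halfPow_le_sqrt _ (hs.2.trans (pow_le_one₀ hδ.le hδ1))).trans
        (Real.sqrt_le_iff.2 ⟨hδ.le, hs.2⟩)
    have h2 : curveSlope n s ≤ 1 :=
      (mul_le_mul_of_nonneg_left h1 (by positivity)).trans hcδ
    exact Real.sqrt_le_iff.2 ⟨by norm_num, by nlinarith [curveSlope_nonneg n s]⟩
  rw [intervalIntegral.integral_const, sub_zero, smul_eq_mul] at h
  linarith

theorem intervalIntegrable_sqrt_sq_add_sq {f g : ℝ → ℝ} {a b : ℝ}
    (hf : IntervalIntegrable f volume a b) (hg : IntervalIntegrable g volume a b) :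
    IntervalIntegrable (fun t ↦ √(f t ^ 2 + g t ^ 2)) volume a b := by
  refine (hf.abs.add hg.abs).mono_fun ?_ (Filter.Eventually.of_forall fun t ↦ ?_)
  · exact Real.continuous_sqrt.comp_aestronglyMeasurable
      ((hf.def'.aestronglyMeasurable.pow 2).add (hg.def'.aestronglyMeasurable.pow 2))
  · change ‖√(f t ^ 2 + g t ^ 2)‖ ≤ ‖|f t| + |g t|‖
    rw [Real.norm_of_nonneg (Real.sqrt_nonneg _)]
    refine le_trans ?_ (le_abs_self _)
    exact Real.sqrt_le_iff.2 ⟨by positivity, by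
      nlinarith [sq_abs (f t), sq_abs (g t), mul_nonneg (abs_nonneg (f t)) (abs_nonneg (g t))]⟩

theorem abs_integral_le_of_abs_le {d w : ℝ → ℝ} {t τ : ℝ} (ht : t ∈ Icc 0 τ)
    (hd : IntervalIntegrable d volume 0 τ) (hw : IntervalIntegrable w volume 0 τ)
    (hdw : ∀ s, |d s| ≤ w s) :
    |∫ s in (0 : ℝ)..t, d s| ≤ ∫ s in (0 : ℝ)..τ, w s := by
  have hsub : uIcc 0 t ⊆ uIcc 0 τ := uIcc_subset_uIcc left_mem_uIcc (Icc_subset_uIcc ht)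
  refine (intervalIntegral.abs_integral_le_integral_abs ht.1).trans ?_
  refine (intervalIntegral.integral_mono_on ht.1 (hd.mono_set hsub).abs (hw.mono_set hsub)
    fun s _ ↦ hdw s).trans ?_
  exact intervalIntegral.integral_mono_interval le_rfl ht.1 ht.2
    (Filter.Eventually.of_forall fun s ↦ (abs_nonneg _).trans (hdw s)) hw

/-- Theorem 1.1 of the paper. For `a = 2` and odd `b ≥ 5`, there exists
`ε > 0` such that the curve `γ_ε(t) = (t^{b/2}, t, 0)` is length-minimizing: every horizontal
curve with the same endpoints has length at least `L(γ_ε)`. -/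
theorem gamma_minimizing (b : ℕ) (hb : 5 ≤ b) (hodd : Odd b) :
    ∃ ε : ℝ, 0 < ε ∧ ∀ τ : ℝ, 0 < τ → ∀ η : HorizontalCurve 2 b τ,
      η.x 0 = 0 → η.y 0 = 0 → η.z 0 = 0 →
      η.x τ = ε ^ ((b : ℝ) / 2) → η.y τ = ε → η.z τ = 0 →
      (∫ t in (0:ℝ)..ε,
          Real.sqrt (1 + ((b : ℝ) / 2) ^ 2 * t ^ (2 * ((b : ℝ) / 2) - 2))) ≤ η.length := by
  obtain ⟨n, rfl⟩ : ∃ n, b = 2 * n + 5 := by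
    obtain ⟨k, rfl⟩ := hodd
    exact ⟨k - 2, by omega⟩
  have hn : (0 : ℝ) ≤ n := n.cast_nonneg
  obtain ⟨δ, hδ, hδ'⟩ : ∃ δ : ℝ, 0 < δ ∧ 100 * (n + 5 / 2 : ℝ) ^ 3 * δ ≤ 1 :=
    ⟨1 / (100 * (n + 5 / 2 : ℝ) ^ 3), by positivity, by
      rw [mul_one_div_cancel (by positivity)]⟩
  have hc1 : 1 ≤ (n + 5 / 2 : ℝ) := by linarith
  have hc3 : (n + 5 / 2 : ℝ) ≤ (n + 5 / 2 : ℝ) ^ 3 := le_self_pow₀ hc1 (by norm_num)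
  have hcδ : (n + 5 / 2 : ℝ) * δ ≤ 1 := by nlinarith
  have hδ1 : δ ≤ 1 := by nlinarith
  refine ⟨δ ^ 2, by positivity, fun τ hτ η hx0 hy0 hz0 hxτ hyτ hzτ ↦ ?_⟩
  have hlen : (∫ t in (0 : ℝ)..(δ ^ 2), √(1 + (((2 * n + 5 : ℕ) : ℝ) / 2) ^ 2 *
      t ^ (2 * (((2 * n + 5 : ℕ) : ℝ) / 2) - 2))) =
      ∫ s in (0 : ℝ)..(δ ^ 2), √(1 + curveSlope n s ^ 2) := by
    refine intervalIntegral.integral_congr fun s hs ↦ ?_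
    rw [uIcc_of_le (sq_nonneg δ)] at hs
    simp only [curveSlope_sq_eq hs.1]
  rw [hlen, HorizontalCurve.length]
  by_contra! hlt
  have hw := intervalIntegrable_sqrt_sq_add_sq η.hd1 η.hd2
  have hL := hlt.le.trans (integral_sqrt_one_add_curveSlope_sq_le hδ hδ1 hcδ)
  have hx := HasACDeriv.of_intervalIntegrable η.hd1
  have hy := HasACDeriv.of_intervalIntegrable η.hd2
  have hxe : ∀ t ∈ Icc 0 τ, η.x t = ∫ s in (0 : ℝ)..t, η.d1 s := fun t ht ↦ by
    rw [η.hx t ht, hx0, zero_add]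
  have hye : ∀ t ∈ Icc 0 τ, η.y t = ∫ s in (0 : ℝ)..t, η.d2 s := fun t ht ↦ by
    rw [η.hy t ht, hy0, zero_add]
  have hτm : τ ∈ Icc 0 τ := right_mem_Icc.2 hτ.le
  have hz := η.hz τ hτm
  rw [hzτ, hz0, zero_add, intervalIntegral.integral_congr (g := fun t ↦ η.d2 t *
    ((∫ s in (0 : ℝ)..t, η.d1 s) ^ 2 - (∫ s in (0 : ℝ)..t, η.d2 s) ^ (2 * n + 5)) ^ 2)
    fun t ht ↦ by
      rw [uIcc_of_le hτ.le] at ht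
      simp only [hxe t ht, hye t ht]] at hz
  rw [hxe τ hτm, rpow_half_eq_halfPow (by positivity)] at hxτ
  rw [hye τ hτm] at hyτ
  have hxb : ∀ t ∈ Icc 0 τ, |∫ s in (0 : ℝ)..t, η.d1 s| ≤ 2 * δ ^ 2 := fun t ht ↦
    (abs_integral_le_of_abs_le ht η.hd1 hw fun s ↦
      Real.abs_le_sqrt (by nlinarith [sq_nonneg (η.d2 s)])).trans hL
  have hyb : ∀ t ∈ Icc 0 τ, |∫ s in (0 : ℝ)..t, η.d2 s| ≤ 2 * δ ^ 2 := fun t ht ↦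
    (abs_integral_le_of_abs_le ht η.hd2 hw fun s ↦
      Real.abs_le_sqrt (by nlinarith [sq_nonneg (η.d1 s)])).trans hL
  have hcont : ContinuousOn (fun t ↦ |(∫ s in (0 : ℝ)..t, η.d1 s) ^ 2 -
      (∫ s in (0 : ℝ)..t, η.d2 s) ^ (2 * n + 5)|) (Icc 0 τ) := by
    have h1 := hx.1.continuousOn
    have h2 := hy.1.continuousOn
    rw [uIcc_of_le hτ.le] at h1 h2
    exact ((h1.pow 2).sub (h2.pow _)).abs
  obtain ⟨σ, hσ, hmax⟩ := isCompact_Icc.exists_isMaxOn ⟨0, left_mem_Icc.2 hτ.le⟩ hcont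
  have hbound := fun (m : ℝ) (hm : 0 < m) hM ↦
    length_lower_bound (m := m) hδ hδ' hm hτ.le hx hy intervalIntegral.integral_same
      intervalIntegral.integral_same hxτ hyτ hxb hyb (fun t ht ↦ (hmax ht).trans hM) hz.symm hσ hw
  have herr : ∀ m : ℝ, 0 < m → 4 * (n + 5 / 2 : ℝ) ^ 3 * m * δ ≤ m / 25 := fun m hm ↦ by
    nlinarith
  set M := |(∫ s in (0 : ℝ)..σ, η.d1 s) ^ 2 - (∫ s in (0 : ℝ)..σ, η.d2 s) ^ (2 * n + 5)|
  have hM : 0 ≤ M := abs_nonneg _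
  rcases hM.eq_or_lt with h | h
  · have hgap := sub_pos.2 hlt
    have h1 := hbound _ hgap (h.symm.trans_le hgap.le)
    have h2 := herr _ hgap
    rw [← h, zero_pow (by norm_num), zero_div] at h1
    linarith
  · have h1 := hbound M h le_rfl
    have h2 := herr M h
    have h3 : M ^ 3 / (12 * M ^ 2) = M / 12 := by field_simp
    rw [h3] at h1
    linarith
end

section
/- Let a, b be natural numbers with b > a ≥ 1, let q = b/a, and let ε > 0. The curve γ_ε(t) = (t^q, t, 0), t ∈ [0,ε], is C¹-rigid: there exists δ > 0 such that every horizontal curve η̃ : [0,ε] → ℝ³ with η̃(0) = (0,0,0), η̃(ε) = (ε^q, ε, 0), sup_{t∈[0,ε]} |η̃(t) − γ_ε(t)| < δ, and with |η̃₁'(t) − q t^{q−1}| < δ and |η̃₂'(t) − 1| < δ for a.e. t ∈ [0,ε], satisfies P(η̃₁(t), η̃₂(t)) = 0 (i.e. η̃₁(t)^a = η̃₂(t)^b) and η̃₃(t) = 0 for all t ∈ [0,ε]; hence η̃ is a reparameterization of γ_ε. -/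
open MeasureTheory Set

/-- A function that is a primitive of an interval integrable function on `[0, τ]` is continuous
there. -/
theorem continuousOn_of_eq_primitive {f g : ℝ → ℝ} {τ : ℝ} (hτ : 0 ≤ τ)
    (hg : IntervalIntegrable g volume 0 τ)
    (hf : ∀ t ∈ Icc (0:ℝ) τ, f t = f 0 + ∫ s in (0:ℝ)..t, g s) :
    ContinuousOn f (Icc 0 τ) := by
  refine ContinuousOn.congr (continuousOn_const.add ?_) hf
  have h := intervalIntegral.continuousOn_primitive_interval' hg left_mem_uIcc
  rwa [uIcc_of_le hτ] at h

theorem HorizontalCurve.continuousOn_defect {a b : ℕ} {τ : ℝ} (η : HorizontalCurve a b τ)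
    (hτ : 0 ≤ τ) : ContinuousOn (fun t => η.x t ^ a - η.y t ^ b) (Icc 0 τ) :=
  ((continuousOn_of_eq_primitive hτ η.hd1 η.hx).pow a).sub
    ((continuousOn_of_eq_primitive hτ η.hd2 η.hy).pow b)

/-- Lemma 2.12 of the paper. For `b > a ≥ 1` and `ε > 0` the curve
`γ_ε(t) = (t^{b/a}, t, 0)` is `C¹`-rigid: every horizontal curve with the same endpoints that is
uniformly `δ`-close to `γ_ε` together with its control satisfies `P(η̃₁, η̃₂) = 0` and `η̃₃ = 0`,
i.e. it is a reparameterization of `γ_ε`. -/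
theorem gamma_C1_rigid (a b : ℕ) (ha : 1 ≤ a) (hab : a < b) (ε : ℝ) (hε : 0 < ε) :
    ∃ δ : ℝ, 0 < δ ∧ ∀ η : HorizontalCurve a b ε,
      η.x 0 = 0 → η.y 0 = 0 → η.z 0 = 0 →
      η.x ε = ε ^ ((b : ℝ) / a) → η.y ε = ε → η.z ε = 0 →
      (∀ t ∈ Icc (0:ℝ) ε, |η.x t - t ^ ((b : ℝ) / a)| < δ ∧ |η.y t - t| < δ ∧ |η.z t| < δ) →
      (∀ᵐ t ∂volume, t ∈ Icc (0:ℝ) ε →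
        |η.d1 t - ((b : ℝ) / a) * t ^ ((b : ℝ) / a - 1)| < δ ∧ |η.d2 t - 1| < δ) →
      ∀ t ∈ Icc (0:ℝ) ε, (η.x t) ^ a = (η.y t) ^ b ∧ η.z t = 0 := by
  refine ⟨1, one_pos, fun η hx0 hy0 hz0 hxε hyε hzε _ hd => ?_⟩
  have hP := η.continuousOn_defect hε.le
  have hint : IntervalIntegrable (fun s => η.d2 s * (η.x s ^ a - η.y s ^ b) ^ 2) volume 0 ε := by
    refine η.hd2.mul_continuousOn ?_
    rw [uIcc_of_le hε.le]
    exact hP.pow 2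
  have hpos : ∀ᵐ t ∂volume.restrict (Ioc 0 ε), 0 < η.d2 t := by
    rw [ae_restrict_iff' measurableSet_Ioc]
    filter_upwards [hd] with t ht hmem
    linarith [(abs_lt.1 (ht (Ioc_subset_Icc_self hmem)).2).1]
  have hzero : ∫ s in (0:ℝ)..ε, η.d2 s * (η.x s ^ a - η.y s ^ b) ^ 2 = 0 := by
    have := η.hz ε ⟨hε.le, le_rfl⟩
    linarith
  rw [intervalIntegral.integral_eq_zero_iff_of_le_of_nonneg_ae hε.le
    (by filter_upwards [hpos] with t ht using by positivity) hint] at hzero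
  have hae : (fun t => η.x t ^ a - η.y t ^ b) =ᵐ[volume.restrict (Icc 0 ε)] fun _ => 0 := by
    rw [← Measure.restrict_congr_set Ioc_ae_eq_Icc]
    filter_upwards [hzero, hpos] with t ht htpos
    simpa [htpos.ne'] using ht
  have hEq : ∀ t ∈ Icc 0 ε, η.x t ^ a - η.y t ^ b = 0 := fun t ht =>
    Measure.eqOn_Icc_of_ae_eq volume hε.ne hae hP continuousOn_const ht
  refine fun t ht => ⟨sub_eq_zero.1 (hEq t ht), ?_⟩
  rw [η.hz t ht, hz0, zero_add, intervalIntegral.integral_congr (g := fun _ => 0)]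
  · simp
  · intro s hs
    rw [uIcc_of_le ht.1] at hs
    simp [hEq s ⟨hs.1, hs.2.trans ht.2⟩]
end

section
/- Let a, b ≥ 1 be natural numbers, let q = b/a, and let ε > 0. Then lim_{δ→0⁺} δ^{−3} · ∫_{ε(1−δ)}^{ε} ∫_{ε^q}^{ε^q(1+δ)} 2a·x₁^{a−1}·(x₁^a − x₂^b) dx₁ dx₂ = a·(a+b)·ε^{2b+1}. Equivalently, the weighted area of the rectangle E_δ = [ε^q, ε^q(1+δ)] × [ε(1−δ), ε] with weight Q(x₁,x₂) = 2a x₁^{a−1}(x₁^a − x₂^b) equals a(a+b)ε^{2b+1}δ³(1 + f_{a,b}(δ)) with f_{a,b}(δ) = O(δ) as δ → 0⁺. -/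
open MeasureTheory Set Filter Asymptotics

/-- Second-order expansion of `(1 + x) ^ n` with a continuous cubic remainder. -/
theorem exists_continuous_one_add_pow_eq (n : ℕ) :
    ∃ S : ℝ → ℝ, Continuous S ∧
      ∀ x : ℝ, (1 + x) ^ n = 1 + n * x + n * (n - 1) / 2 * x ^ 2 + x ^ 3 * S x := by
  induction n with
  | zero => exact ⟨fun _ => 0, continuous_const, fun x => by simp⟩
  | succ n ih =>
    obtain ⟨S, hS, h⟩ := ih
    refine ⟨fun x => n * (n - 1) / 2 + (1 + x) * S x, by fun_prop, fun x => ?_⟩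
    rw [pow_succ, h]
    push_cast
    ring

theorem integral_weight_fst (a : ℕ) (c l r : ℝ) :
    ∫ x in l..r, 2 * a * x ^ (a - 1) * (x ^ a - c)
      = (r ^ a) ^ 2 - (l ^ a) ^ 2 - 2 * c * (r ^ a - l ^ a) := by
  have hderiv : ∀ x ∈ uIcc l r, HasDerivAt (fun x : ℝ => (x ^ a) ^ 2 - 2 * c * x ^ a)
      (2 * a * x ^ (a - 1) * (x ^ a - c)) x := fun x _ => by
    have h := hasDerivAt_pow a x
    refine ((h.pow 2).sub (h.const_mul (2 * c))).congr_deriv ?_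
    push_cast
    ring
  rw [intervalIntegral.integral_eq_sub_of_hasDerivAt hderiv
    (Continuous.intervalIntegrable (by fun_prop) _ _)]
  ring

theorem integral_weight_rectangle (a b : ℕ) (ε X δ : ℝ) (hX : X ^ a = ε ^ b) :
    ∫ x2 in (ε * (1 - δ))..ε, ∫ x1 in X..(X * (1 + δ)),
        2 * a * x1 ^ (a - 1) * (x1 ^ a - x2 ^ b)
      = ε ^ (2 * b + 1) * (((1 + δ) ^ a - 1) *
          (δ * ((1 + δ) ^ a + 1) - 2 * ((1 - (1 - δ) ^ (b + 1)) / (b + 1)))) := by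
  have hb : (b : ℝ) + 1 ≠ 0 := by positivity
  simp_rw [integral_weight_fst a, mul_pow, hX]
  rw [intervalIntegral.integral_sub (by simp)
    (Continuous.intervalIntegrable (by fun_prop) _ _), intervalIntegral.integral_const,
    intervalIntegral.integral_mul_const, intervalIntegral.integral_const_mul, integral_pow,
    smul_eq_mul, mul_pow]
  field_simp
  ring

/-- The normalized area expands as `a (a + b) δ ^ 3` times `1 + δ g(δ)` with `g` continuous. -/
theorem exists_continuous_rectangle_expansion (a b : ℕ) (ha : 1 ≤ a) :
    ∃ g : ℝ → ℝ, Continuous g ∧ ∀ δ : ℝ,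
      ((1 + δ) ^ a - 1) * (δ * ((1 + δ) ^ a + 1) - 2 * ((1 - (1 - δ) ^ (b + 1)) / (b + 1)))
        = (a : ℝ) * (a + b) * δ ^ 3 * (1 + δ * g δ) := by
  obtain ⟨R, hR, hRa⟩ := exists_continuous_one_add_pow_eq a
  obtain ⟨S, hS, hSb⟩ := exists_continuous_one_add_pow_eq (b + 1)
  have ha' : (0 : ℝ) < a := by exact_mod_cast ha
  have hab : (a : ℝ) + b ≠ 0 := by positivity
  have hb : (b : ℝ) + 1 ≠ 0 := by positivity
  let U : ℝ → ℝ := fun δ => a * (a - 1) / 2 + δ * R δ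
  let V : ℝ → ℝ := fun δ => U δ - 2 * S (-δ) / (b + 1)
  have hU : Continuous U := by fun_prop
  have hV : Continuous V := by fun_prop
  refine ⟨fun δ => (a * V δ + (a + b) * U δ + δ * U δ * V δ) / (a * (a + b)),
    by fun_prop, fun δ => ?_⟩
  have h1 : (1 + δ) ^ a = 1 + a * δ + δ ^ 2 * U δ := by
    rw [hRa]
    ring
  have h2 : (1 - (1 - δ) ^ (b + 1)) / ((b : ℝ) + 1)
      = δ - b / 2 * δ ^ 2 + δ ^ 3 * (S (-δ) / (b + 1)) := by
    rw [sub_eq_add_neg 1 δ, hSb]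
    push_cast
    field_simp
    ring
  have h3 : S (-δ) / ((b : ℝ) + 1) = (U δ - V δ) / 2 := by
    simp only [V]
    ring
  rw [h1, h2, h3]
  field_simp
  ring

/-- the rectangle correction, eq. (2.26)–(2.31) of the paper. The weighted
area of the rectangle `E_δ = [ε^q, ε^q(1+δ)] × [ε(1−δ), ε]` with weight
`Q(x₁,x₂) = 2a·x₁^{a−1}·(x₁^a − x₂^b)` is `a(a+b)ε^{2b+1}δ³(1 + O(δ))` as `δ → 0⁺`; in
particular `δ⁻³` times it tends to `a(a+b)ε^{2b+1}`. -/
theorem rectangle_weighted_area_asymptotics (a b : ℕ) (ha : 1 ≤ a) (hb : 1 ≤ b)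
    (q : ℝ) (hq : q = (b : ℝ) / a) (ε : ℝ) (hε : 0 < ε) :
    Tendsto (fun δ : ℝ => (δ ^ 3)⁻¹ *
        ∫ x2 in (ε * (1 - δ))..ε, ∫ x1 in (ε ^ q)..(ε ^ q * (1 + δ)),
          2 * a * x1 ^ (a - 1) * (x1 ^ a - x2 ^ b))
      (nhdsWithin 0 (Ioi 0)) (nhds ((a : ℝ) * (a + b) * ε ^ (2 * b + 1)))
    ∧
    ∃ f : ℝ → ℝ, f =O[nhdsWithin 0 (Ioi 0)] (fun δ => δ) ∧
      ∀ᶠ δ : ℝ in nhdsWithin 0 (Ioi 0),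
        (∫ x2 in (ε * (1 - δ))..ε, ∫ x1 in (ε ^ q)..(ε ^ q * (1 + δ)),
            2 * a * x1 ^ (a - 1) * (x1 ^ a - x2 ^ b))
          = (a : ℝ) * (a + b) * ε ^ (2 * b + 1) * δ ^ 3 * (1 + f δ) := by
  have ha' : (0 : ℝ) < a := by exact_mod_cast ha
  have hX : (ε ^ q) ^ a = ε ^ b := by
    rw [← Real.rpow_natCast, ← Real.rpow_mul hε.le, hq, div_mul_cancel₀ _ ha'.ne',
      Real.rpow_natCast]
  obtain ⟨g, hg, hgδ⟩ := exists_continuous_rectangle_expansion a b ha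
  have harea : ∀ δ : ℝ, (∫ x2 in (ε * (1 - δ))..ε, ∫ x1 in (ε ^ q)..(ε ^ q * (1 + δ)),
        2 * a * x1 ^ (a - 1) * (x1 ^ a - x2 ^ b))
      = (a : ℝ) * (a + b) * ε ^ (2 * b + 1) * δ ^ 3 * (1 + δ * g δ) := fun δ => by
    rw [integral_weight_rectangle a b ε _ δ hX, hgδ]
    ring
  refine ⟨?_, fun δ => δ * g δ, ?_, Eventually.of_forall harea⟩
  · have hlim : Tendsto (fun δ : ℝ => (a : ℝ) * (a + b) * ε ^ (2 * b + 1) * (1 + δ * g δ))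
        (nhdsWithin 0 (Ioi 0)) (nhds ((a : ℝ) * (a + b) * ε ^ (2 * b + 1))) := by
      refine tendsto_nhdsWithin_of_tendsto_nhds (Continuous.tendsto' (by fun_prop) _ _ ?_)
      simp
    refine hlim.congr' ?_
    filter_upwards [self_mem_nhdsWithin] with δ hδ
    have hδ0 : δ ≠ 0 := ne_of_gt hδ
    rw [harea]
    field_simp
  · have hgO : g =O[nhdsWithin 0 (Ioi 0)] (fun _ => (1 : ℝ)) :=
      ((hg.tendsto 0).mono_left nhdsWithin_le_nhds).isBigO_one ℝ
    simpa using (isBigO_refl (fun δ : ℝ => δ) _).mul hgO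
end

section
/- Let q > 1 be a real number. Then lim_{ρ→0⁺} ρ^{−(2q−1)} · ( ∫₀^ρ √(1 + q²·t^{2q−2}) dt − √(ρ² + ρ^{2q}) ) = (q−1)² / (2(2q−1)). In particular, there exists ρ₀ > 0 such that for all 0 < ρ < ρ₀, ∫₀^ρ √(1 + q² t^{2q−2}) dt − √(ρ² + ρ^{2q}) ≥ ((q−1)²/(4(2q−1)))·ρ^{2q−1}. -/
open MeasureTheory Set Filter

theorem sqrt_one_add_le_one_add_half {x : ℝ} (hx : 0 ≤ x) : Real.sqrt (1 + x) ≤ 1 + x / 2 :=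
  Real.sqrt_le_iff.mpr ⟨by positivity, by nlinarith [sq_nonneg x]⟩

theorem one_add_half_sub_sq_le_sqrt_one_add {x : ℝ} (hx : 0 ≤ x) :
    1 + x / 2 - x ^ 2 / 8 ≤ Real.sqrt (1 + x) := by
  rcases le_total x 8 with h | h
  · apply Real.le_sqrt_of_sq_le
    nlinarith [mul_nonneg (pow_nonneg hx 3) (sub_nonneg.mpr h)]
  · refine le_trans ?_ (Real.sqrt_nonneg _)
    nlinarith

theorem integral_one_add_mul_rpow {p : ℝ} (hp : 0 < p) (a b ρ : ℝ) :
    ∫ t in (0:ℝ)..ρ, (1 + a * t ^ p - b * t ^ (2 * p)) =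
      ρ + a * (ρ ^ (p + 1) / (p + 1)) - b * (ρ ^ (2 * p + 1) / (2 * p + 1)) := by
  have h1 : IntervalIntegrable (fun t : ℝ => t ^ p) volume 0 ρ :=
    intervalIntegral.intervalIntegrable_rpow' (by linarith)
  have h2 : IntervalIntegrable (fun t : ℝ => t ^ (2 * p)) volume 0 ρ :=
    intervalIntegral.intervalIntegrable_rpow' (by linarith)
  rw [intervalIntegral.integral_sub (intervalIntegrable_const.add (h1.const_mul a))
      (h2.const_mul b), intervalIntegral.integral_add intervalIntegrable_const (h1.const_mul a),
    intervalIntegral.integral_const_mul, intervalIntegral.integral_const_mul,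
    integral_rpow (Or.inl (by linarith)), integral_rpow (Or.inl (by linarith)),
    Real.zero_rpow (by linarith), Real.zero_rpow (by linarith)]
  simp

theorem continuous_one_add_mul_rpow {p : ℝ} (hp : 0 < p) (a b : ℝ) :
    Continuous fun t : ℝ => 1 + a * t ^ p - b * t ^ (2 * p) := by
  have h1 := Real.continuous_rpow_const hp.le
  have h2 := Real.continuous_rpow_const (show 0 ≤ 2 * p by linarith)
  fun_prop

theorem continuous_sqrt_one_add_mul_rpow {p : ℝ} (hp : 0 < p) (a : ℝ) :
    Continuous fun t : ℝ => Real.sqrt (1 + a * t ^ p) := by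
  have h1 := Real.continuous_rpow_const hp.le
  fun_prop

theorem integral_sqrt_one_add_mul_rpow_le {p a ρ : ℝ} (hp : 0 < p) (ha : 0 ≤ a) (hρ : 0 ≤ ρ) :
    ∫ t in (0:ℝ)..ρ, Real.sqrt (1 + a * t ^ p) ≤ ρ + a / 2 * (ρ ^ (p + 1) / (p + 1)) := by
  have h := integral_one_add_mul_rpow hp (a / 2) 0 ρ
  rw [zero_mul, sub_zero] at h
  rw [← h]
  refine intervalIntegral.integral_mono_on hρ
    ((continuous_sqrt_one_add_mul_rpow hp a).intervalIntegrable _ _)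
    ((continuous_one_add_mul_rpow hp _ _).intervalIntegrable _ _) fun t ht => ?_
  have := sqrt_one_add_le_one_add_half (mul_nonneg ha (Real.rpow_nonneg ht.1 p))
  linarith

theorem le_integral_sqrt_one_add_mul_rpow {p a ρ : ℝ} (hp : 0 < p) (ha : 0 ≤ a) (hρ : 0 ≤ ρ) :
    ρ + a / 2 * (ρ ^ (p + 1) / (p + 1)) - a ^ 2 / 8 * (ρ ^ (2 * p + 1) / (2 * p + 1)) ≤
      ∫ t in (0:ℝ)..ρ, Real.sqrt (1 + a * t ^ p) := by
  rw [← integral_one_add_mul_rpow hp]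
  refine intervalIntegral.integral_mono_on hρ
    ((continuous_one_add_mul_rpow hp _ _).intervalIntegrable _ _)
    ((continuous_sqrt_one_add_mul_rpow hp a).intervalIntegrable _ _) fun t ht => ?_
  have h := one_add_half_sub_sq_le_sqrt_one_add (mul_nonneg ha (Real.rpow_nonneg ht.1 p))
  have h2 : t ^ (2 * p) = (t ^ p) ^ 2 := by
    rw [mul_comm, Real.rpow_mul ht.1, Real.rpow_two]
  rw [h2]
  linarith

theorem sqrt_sq_add_rpow {q ρ : ℝ} (hρ : 0 < ρ) :
    Real.sqrt (ρ ^ 2 + ρ ^ (2 * q)) = ρ * Real.sqrt (1 + ρ ^ (2 * q - 2)) := by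
  have h : ρ ^ 2 + ρ ^ (2 * q) = ρ ^ 2 * (1 + ρ ^ (2 * q - 2)) := by
    rw [mul_add, mul_one, ← Real.rpow_two, ← Real.rpow_add hρ]
    ring_nf
  rw [h, Real.sqrt_mul (by positivity), Real.sqrt_sq hρ.le]

theorem length_gain_bounds {q ρ : ℝ} (hq : 1 < q) (hρ : 0 < ρ) :
    (q - 1) ^ 2 / (2 * (2 * q - 1)) - q ^ 4 / (8 * (4 * q - 3)) * ρ ^ (2 * q - 2) ≤
        ρ ^ (-(2 * q - 1)) *
          ((∫ t in (0:ℝ)..ρ, Real.sqrt (1 + q ^ 2 * t ^ (2 * q - 2)))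
            - Real.sqrt (ρ ^ 2 + ρ ^ (2 * q))) ∧
      ρ ^ (-(2 * q - 1)) *
          ((∫ t in (0:ℝ)..ρ, Real.sqrt (1 + q ^ 2 * t ^ (2 * q - 2)))
            - Real.sqrt (ρ ^ 2 + ρ ^ (2 * q))) ≤
        (q - 1) ^ 2 / (2 * (2 * q - 1)) + 1 / 8 * ρ ^ (2 * q - 2) := by
  have hp : 0 < 2 * q - 2 := by linarith
  have hu := integral_sqrt_one_add_mul_rpow_le hp (sq_nonneg q) hρ.le
  have hl := le_integral_sqrt_one_add_mul_rpow hp (sq_nonneg q) hρ.le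
  rw [sqrt_sq_add_rpow hρ]
  have e1 : ρ ^ (2 * q - 2 + 1) = ρ * ρ ^ (2 * q - 2) := by
    rw [Real.rpow_add_one hρ.ne', mul_comm]
  have e2 : ρ ^ (2 * (2 * q - 2) + 1) = ρ * (ρ ^ (2 * q - 2)) ^ 2 := by
    rw [Real.rpow_add_one hρ.ne', mul_comm 2, Real.rpow_mul hρ.le, Real.rpow_two, mul_comm]
  have e3 : ρ ^ (-(2 * q - 1)) = (ρ * ρ ^ (2 * q - 2))⁻¹ := by
    rw [Real.rpow_neg hρ.le, ← e1]
    ring_nf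
  rw [e1] at hu
  rw [e1, e2] at hl
  rw [e3]
  have hs : 0 < ρ ^ (2 * q - 2) := Real.rpow_pos_of_pos hρ _
  generalize ρ ^ (2 * q - 2) = s at *
  have hcu := mul_le_mul_of_nonneg_left (sqrt_one_add_le_one_add_half hs.le) hρ.le
  have hcl := mul_le_mul_of_nonneg_left (one_add_half_sub_sq_le_sqrt_one_add hs.le) hρ.le
  have hc : (q - 1) ^ 2 / (2 * (2 * q - 1)) = q ^ 2 / 2 / (2 * q - 1) - 1 / 2 := by
    have hq1 : 2 * q - 1 ≠ 0 := by linarith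
    rw [div_div, div_sub_div _ _ (by positivity) two_ne_zero,
      div_eq_div_iff (by positivity) (by positivity)]
    ring
  have d1 : 2 * q - 2 + 1 = 2 * q - 1 := by ring
  have d2 : 2 * (2 * q - 2) + 1 = 4 * q - 3 := by ring
  rw [d1] at hu
  rw [d1, d2] at hl
  rw [hc, ← div_div (q ^ 4), inv_mul_eq_div, le_div_iff₀ (by positivity), div_le_iff₀ (by positivity)]
  constructor
  · refine le_trans (le_of_eq ?_) (sub_le_sub hl hcu)
    ring
  · refine le_trans (sub_le_sub hu hcl) (le_of_eq ?_)
    ring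

/-- the length gain of the cut, eq. (3.17)–(3.19) of the paper. For `q > 1`,
the difference between the length `∫₀^ρ √(1+q²t^{2q−2}) dt` of the arc `t ↦ (t^q,t)` and the
length `√(ρ²+ρ^{2q})` of its chord is asymptotic to `((q−1)²/(2(2q−1)))·ρ^{2q−1}` as `ρ → 0⁺`;
in particular it is at least `((q−1)²/(4(2q−1)))·ρ^{2q−1}` for all small `ρ > 0`. -/
theorem length_gain_asymptotics (q : ℝ) (hq : 1 < q) :
    Tendsto (fun ρ : ℝ => ρ ^ (-(2 * q - 1)) *
        ((∫ t in (0:ℝ)..ρ, Real.sqrt (1 + q ^ 2 * t ^ (2 * q - 2)))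
          - Real.sqrt (ρ ^ 2 + ρ ^ (2 * q))))
      (nhdsWithin 0 (Ioi 0)) (nhds ((q - 1) ^ 2 / (2 * (2 * q - 1))))
    ∧
    ∃ ρ₀ : ℝ, 0 < ρ₀ ∧ ∀ ρ : ℝ, 0 < ρ → ρ < ρ₀ →
      ((q - 1) ^ 2 / (4 * (2 * q - 1))) * ρ ^ (2 * q - 1) ≤
        (∫ t in (0:ℝ)..ρ, Real.sqrt (1 + q ^ 2 * t ^ (2 * q - 2)))
          - Real.sqrt (ρ ^ 2 + ρ ^ (2 * q)) := by
  have hs : Tendsto (fun ρ : ℝ => ρ ^ (2 * q - 2)) (nhdsWithin 0 (Ioi 0)) (nhds 0) := by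
    have h := (Real.continuous_rpow_const (show 0 ≤ 2 * q - 2 by linarith)).tendsto 0
    rw [Real.zero_rpow (by linarith)] at h
    exact h.mono_left nhdsWithin_le_nhds
  have hlim : Tendsto (fun ρ : ℝ => ρ ^ (-(2 * q - 1)) *
        ((∫ t in (0:ℝ)..ρ, Real.sqrt (1 + q ^ 2 * t ^ (2 * q - 2)))
          - Real.sqrt (ρ ^ 2 + ρ ^ (2 * q))))
      (nhdsWithin 0 (Ioi 0)) (nhds ((q - 1) ^ 2 / (2 * (2 * q - 1)))) := by
    refine tendsto_of_tendsto_of_tendsto_of_le_of_le'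
      (g := fun ρ => (q - 1) ^ 2 / (2 * (2 * q - 1)) -
        q ^ 4 / (8 * (4 * q - 3)) * ρ ^ (2 * q - 2))
      (h := fun ρ => (q - 1) ^ 2 / (2 * (2 * q - 1)) + 1 / 8 * ρ ^ (2 * q - 2)) ?_ ?_
      (eventually_mem_nhdsWithin.mono fun ρ hρ => (length_gain_bounds hq hρ).1)
      (eventually_mem_nhdsWithin.mono fun ρ hρ => (length_gain_bounds hq hρ).2)
    · simpa using tendsto_const_nhds.sub (hs.const_mul (q ^ 4 / (8 * (4 * q - 3))))
    · simpa only [mul_zero, add_zero] using (hs.const_mul (1 / 8)).const_add ((q - 1) ^ 2 / (2 * (2 * q - 1)))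
  refine ⟨hlim, ?_⟩
  have hq1 : 0 < 2 * q - 1 := by linarith
  have hc : (q - 1) ^ 2 / (4 * (2 * q - 1)) < (q - 1) ^ 2 / (2 * (2 * q - 1)) :=
    div_lt_div_of_pos_left (pow_pos (by linarith) 2) (by positivity) (by linarith)
  obtain ⟨ρ₀, hρ₀, h⟩ := mem_nhdsGT_iff_exists_Ioo_subset.mp (hlim.eventually_const_lt hc)
  refine ⟨ρ₀, hρ₀, fun ρ hρ hlt => ?_⟩
  have hb : (q - 1) ^ 2 / (4 * (2 * q - 1)) < _ := h ⟨hρ, hlt⟩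
  rw [Real.rpow_neg hρ.le, inv_mul_eq_div, lt_div_iff₀ (Real.rpow_pos_of_pos hρ _)] at hb
  exact hb.le
end
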